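/- For every even integer v ≥ 8, C(4v, 5, 4, 6) ≤ 2·(C(v, 5, 4, 5) + C(v, 5, 4)) + 3v(v−1)·⌈(v/3)·⌈(v−1)/2⌉⌉. -/

import Mathlib

/-- `(X, Bs)` is a `(|X|, k, t, m)` cover: `Bs` is a collection of `k`-subsets of `X` such that
every `m`-subset of `X` intersects at least one block of `Bs` in at least `t` points. -/
def IsCover {α : Type*} [DecidableEq α] (X : Finset α) (Bs : Finset (Finset α))
    (k t m : ℕ) : Prop :=
  (∀ B ∈ Bs, B ⊆ X ∧ B.card = k) ∧
  ∀ M ⊆ X, M.card = m → ∃ B ∈ Bs, t ≤ (M ∩ B).card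

/-- The cover number `C(v,k,t,m)`: the minimum number of blocks of a `(v,k,t,m)` cover.
The covering number `C(v,k,t)` is `C(v,k,t,t)`. -/
noncomputable def coverNumber (v k t m : ℕ) : ℕ :=
  sInf { b | ∃ Bs : Finset (Finset (Fin v)),
    IsCover Finset.univ Bs k t m ∧ Bs.card = b }

open Finset

section Transport

theorem IsCover.map {α β : Type*} [DecidableEq α] [DecidableEq β] {X : Finset α}
    {Bs : Finset (Finset α)} {k t m : ℕ} (h : IsCover X Bs k t m) (e : α ≃ β) :
    IsCover (X.map e.toEmbedding) (Bs.map (Finset.mapEmbedding e.toEmbedding).toEmbedding)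
      k t m := by
  refine ⟨?_, fun M hM hc => ?_⟩
  · intro B hB
    obtain ⟨C, hC, rfl⟩ := Finset.mem_map.1 hB
    obtain ⟨h1, h2⟩ := h.1 C hC
    exact ⟨by simpa using h1, by simpa using h2⟩
  · obtain ⟨B, hB, ht⟩ := h.2 (M.map e.symm.toEmbedding)
      (by
        intro x hx
        obtain ⟨y, hy, rfl⟩ := Finset.mem_map.1 hx
        obtain ⟨z, hz, rfl⟩ := Finset.mem_map.1 (hM hy)
        simpa using hz) (by simpa using hc)
    refine ⟨B.map e.toEmbedding, Finset.mem_map.2 ⟨B, hB, rfl⟩, ht.trans ?_⟩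
    rw [← Finset.card_map e.toEmbedding]
    refine Finset.card_le_card fun x hx => ?_
    simp only [Finset.mem_map, Finset.mem_inter] at hx
    obtain ⟨y, ⟨⟨z, hz, rfl⟩, hy⟩, rfl⟩ := hx
    simp only [Finset.mem_inter, Finset.mem_map]
    exact ⟨by simpa using hz, _, hy, rfl⟩

theorem coverNumber_le_card {α : Type*} [Fintype α] [DecidableEq α] {Bs : Finset (Finset α)}
    {k t m : ℕ} (h : IsCover univ Bs k t m) :
    coverNumber (Fintype.card α) k t m ≤ Bs.card := by
  exact Nat.sInf_le ⟨Bs.map (mapEmbedding (Fintype.equivFin α).toEmbedding).toEmbedding,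
    by simpa using h.map (Fintype.equivFin α), card_map _⟩

theorem exists_isCover_card_eq_coverNumber (α : Type*) [Fintype α] [DecidableEq α]
    {k t m : ℕ} (hk : k ≤ Fintype.card α) (htk : t ≤ k) (htm : t ≤ m) :
    ∃ Bs : Finset (Finset α), IsCover univ Bs k t m ∧
      Bs.card = coverNumber (Fintype.card α) k t m := by
  have hne : { b | ∃ Bs : Finset (Finset (Fin (Fintype.card α))),
      IsCover Finset.univ Bs k t m ∧ Bs.card = b }.Nonempty := by
    refine ⟨_, powersetCard k univ, ⟨fun B hB => ?_, fun M _ hc => ?_⟩, rfl⟩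
    · exact mem_powersetCard.1 hB
    · obtain ⟨N, hN, hNc⟩ := exists_subset_card_eq (htm.trans_eq hc.symm)
      obtain ⟨B, hB, hBc⟩ := exists_superset_card_eq (s := N) (n := k) (by omega) (by simpa using hk)
      refine ⟨B, mem_powersetCard.2 ⟨subset_univ _, hBc⟩, ?_⟩
      rw [← hNc]
      exact card_le_card (subset_inter hN hB)
  obtain ⟨Bs, h, hc⟩ := Nat.sInf_mem hne
  refine ⟨Bs.map (mapEmbedding (Fintype.equivFin α).symm.toEmbedding).toEmbedding, ?_, ?_⟩
  · simpa using h.map (Fintype.equivFin α).symm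
  · rw [card_map]; exact hc

/-- Small blocks may be padded to the prescribed block size. -/
theorem coverNumber_le_card_of_card_le {α : Type*} [Fintype α] [DecidableEq α]
    {F : Finset (Finset α)} {k t m : ℕ} (hk : k ≤ Fintype.card α) (hF : ∀ B ∈ F, B.card ≤ k)
    (h : ∀ M : Finset α, M.card = m → ∃ B ∈ F, t ≤ (M ∩ B).card) :
    coverNumber (Fintype.card α) k t m ≤ F.card := by
  have hpad : ∀ B : Finset α, ∃ C : Finset α, B.card ≤ k → B ⊆ C ∧ C.card = k := by
    intro B
    by_cases hB : B.card ≤ k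
    · obtain ⟨C, h1, h2⟩ := exists_superset_card_eq hB (by simpa using hk)
      exact ⟨C, fun _ => ⟨h1, h2⟩⟩
    · exact ⟨B, fun h => absurd h hB⟩
  choose pad hpad using hpad
  refine (coverNumber_le_card (Bs := F.image pad) ⟨?_, fun M _ hM => ?_⟩).trans card_image_le
  · intro B hB
    obtain ⟨C, hC, rfl⟩ := mem_image.1 hB
    exact ⟨subset_univ _, (hpad C (hF C hC)).2⟩
  · obtain ⟨B, hB, ht⟩ := h M hM
    exact ⟨pad B, mem_image_of_mem _ hB,
      ht.trans (card_le_card (inter_subset_inter_left (hpad B (hF B hB)).1))⟩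

end Transport

section Assembly

variable {V : Type*} [DecidableEq V]

/-- A two-part block is a pair of sets; a family of these joins `p` to `q` if one of its members
contains `p` in its first part and `q` in its second part. -/
def Joins (E : Finset (Finset V × Finset V)) (p q : Finset V) : Prop :=
  ∃ b ∈ E, p ⊆ b.1 ∧ q ⊆ b.2

/-- Every pair is joined to every pair, by blocks of size at most five. -/
structure JoinsPairs (E : Finset (Finset V × Finset V)) : Prop where
  card_le : ∀ b ∈ E, b.1.card + b.2.card ≤ 5
  joins : ∀ p q : Finset V, p.card = 2 → q.card = 2 → Joins E p q

theorem four_le_card_inter {M : Finset (Fin 4 × V)} {i j : Fin 4} (hij : i ≠ j)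
    {P R p q : Finset V} (hP : ∀ x ∈ P, (i, x) ∈ M) (hR : ∀ x ∈ R, (j, x) ∈ M)
    (h4 : 4 ≤ P.card + R.card) (hp : P ⊆ p) (hq : R ⊆ q) :
    4 ≤ (M ∩ (p.image (Prod.mk i) ∪ q.image (Prod.mk j))).card := by
  have hd : Disjoint (P.image (Prod.mk i)) (R.image (Prod.mk j)) := by
    rw [disjoint_left]
    simp only [mem_image, not_exists, not_and]
    rintro _ ⟨x, _, rfl⟩ y _ h
    exact hij (congrArg Prod.fst h).symm
  have hc : (P.image (Prod.mk i) ∪ R.image (Prod.mk j)).card = P.card + R.card := by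
    rw [card_union_of_disjoint hd, card_image_of_injective _ (Prod.mk_right_injective i),
      card_image_of_injective _ (Prod.mk_right_injective j)]
  rw [← hc] at h4
  refine h4.trans (card_le_card (subset_inter ?_ ?_))
  · intro x hx
    rcases mem_union.1 hx with hx | hx <;> obtain ⟨y, hy, rfl⟩ := mem_image.1 hx
    · exact hP y hy
    · exact hR y hy
  · exact union_subset_union (image_subset_image hp) (image_subset_image hq)

theorem le_card_inter_image {M : Finset (Fin 4 × V)} {i : Fin 4} {N B : Finset V} {n : ℕ}
    (hN : ∀ x ∈ N, (i, x) ∈ M) (h : n ≤ (N ∩ B).card) :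
    n ≤ (M ∩ B.image (Prod.mk i)).card := by
  rw [← card_image_of_injective _ (Prod.mk_right_injective i)] at h
  refine h.trans (card_le_card fun x hx => ?_)
  obtain ⟨y, hy, rfl⟩ := mem_image.1 hx
  rw [mem_inter] at hy
  exact mem_inter.2 ⟨hN y hy.1, mem_image_of_mem _ hy.2⟩

theorem coverNumber_le_of_joins [Fintype V] (h5 : 5 ≤ Fintype.card V)
    {E F F' : Finset (Finset V × Finset V)}
    (hE : JoinsPairs E) (hF : JoinsPairs F) (hF' : JoinsPairs F')
    (hgood : ∀ t : Finset V, t.card = 3 → (∀ x, Joins E {x} t) ∨ ∀ x, Joins F t {x})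
    (hbad : ∀ t : Finset V, t.card = 3 → (∀ x, Joins F {x} t) ∨ ∀ x, Joins F' {x} t)
    (hQ : ∀ Q : Finset V, Q.card = 4 → ∀ x, ∃ t ⊆ Q, t.card = 3 ∧ Joins F {x} t)
    (hQ' : ∀ Q : Finset V, Q.card = 4 → ∀ x, ∃ t ⊆ Q, t.card = 3 ∧ Joins F' {x} t) :
    coverNumber (4 * Fintype.card V) 5 4 6 ≤
      2 * (coverNumber (Fintype.card V) 5 4 5 + coverNumber (Fintype.card V) 5 4 4) +
        2 * (E.card + F.card + F'.card) := by
  obtain ⟨g, hg, hgc⟩ := exists_isCover_card_eq_coverNumber V (k := 5) (t := 4) (m := 4)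
    h5 (by norm_num) le_rfl
  obtain ⟨b, hb, hbc⟩ := exists_isCover_card_eq_coverNumber V (k := 5) (t := 4) (m := 5)
    h5 (by norm_num) (by norm_num)
  let I : Fin 4 → Finset (Finset V) → Finset (Finset (Fin 4 × V)) :=
    fun i s => s.image fun B => B.image (Prod.mk i)
  let J : Fin 4 → Fin 4 → Finset (Finset V × Finset V) → Finset (Finset (Fin 4 × V)) :=
    fun i j s => s.image fun B => B.1.image (Prod.mk i) ∪ B.2.image (Prod.mk j)
  let Bs : Finset (Finset (Fin 4 × V)) :=
    (I 0 g ∪ I 1 g ∪ I 2 b ∪ I 3 b) ∪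
      (J 0 1 E ∪ J 3 0 E ∪ J 0 2 F ∪ J 1 3 F ∪ J 1 2 F' ∪ J 2 3 F')
  have hI : ∀ i s, (I i s).card ≤ s.card := fun i s => card_image_le
  have hJ : ∀ i j s, (J i j s).card ≤ s.card := fun i j s => card_image_le
  have hBs : Bs.card ≤ 2 * (b.card + g.card) + 2 * (E.card + F.card + F'.card) := by
    have h1 := card_union_le (I 0 g ∪ I 1 g ∪ I 2 b ∪ I 3 b)
      (J 0 1 E ∪ J 3 0 E ∪ J 0 2 F ∪ J 1 3 F ∪ J 1 2 F' ∪ J 2 3 F')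
    have h2 := card_union_le (I 0 g ∪ I 1 g ∪ I 2 b) (I 3 b)
    have h3 := card_union_le (I 0 g ∪ I 1 g) (I 2 b)
    have h4 := card_union_le (I 0 g) (I 1 g)
    have h5 := card_union_le (J 0 1 E ∪ J 3 0 E ∪ J 0 2 F ∪ J 1 3 F ∪ J 1 2 F') (J 2 3 F')
    have h6 := card_union_le (J 0 1 E ∪ J 3 0 E ∪ J 0 2 F ∪ J 1 3 F) (J 1 2 F')
    have h7 := card_union_le (J 0 1 E ∪ J 3 0 E ∪ J 0 2 F) (J 1 3 F)
    have h8 := card_union_le (J 0 1 E ∪ J 3 0 E) (J 0 2 F)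
    have h9 := card_union_le (J 0 1 E) (J 3 0 E)
    have := hI 0 g
    have := hI 1 g
    have := hI 2 b
    have := hI 3 b
    have := hJ 0 1 E
    have := hJ 3 0 E
    have := hJ 0 2 F
    have := hJ 1 3 F
    have := hJ 1 2 F'
    have := hJ 2 3 F'
    change ((I 0 g ∪ I 1 g ∪ I 2 b ∪ I 3 b) ∪
      (J 0 1 E ∪ J 3 0 E ∪ J 0 2 F ∪ J 1 3 F ∪ J 1 2 F' ∪ J 2 3 F')).card ≤ _
    omega
  have hcard : Fintype.card (Fin 4 × V) = 4 * Fintype.card V := by simp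
  rw [← hbc, ← hgc, ← hcard]
  refine le_trans (coverNumber_le_card_of_card_le (F := Bs) (by omega) ?_ ?_) hBs
  · have hI5 : ∀ i s, (∀ B ∈ s, B ⊆ univ ∧ B.card = 5) → ∀ B ∈ I i s, B.card ≤ 5 := by
      intro i s hs B hB
      obtain ⟨C, hC, rfl⟩ := mem_image.1 hB
      exact card_image_le.trans (hs C hC).2.le
    have hJ5 : ∀ i j s, JoinsPairs s → ∀ B ∈ J i j s, B.card ≤ 5 := by
      intro i j s hs B hB
      obtain ⟨C, hC, rfl⟩ := mem_image.1 hB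
      exact (card_union_le _ _).trans
        ((add_le_add card_image_le card_image_le).trans (hs.card_le C hC))
    intro B hB
    simp only [Bs, mem_union] at hB
    rcases hB with (((h | h) | h) | h) | (((((h | h) | h) | h) | h) | h)
    · exact hI5 _ _ hg.1 _ h
    · exact hI5 _ _ hg.1 _ h
    · exact hI5 _ _ hb.1 _ h
    · exact hI5 _ _ hb.1 _ h
    · exact hJ5 _ _ _ hE _ h
    · exact hJ5 _ _ _ hE _ h
    · exact hJ5 _ _ _ hF _ h
    · exact hJ5 _ _ _ hF _ h
    · exact hJ5 _ _ _ hF' _ h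
    · exact hJ5 _ _ _ hF' _ h
  · intro M hM
    let S : Fin 4 → Finset V := fun i => univ.filter fun x => (i, x) ∈ M
    have hS : ∀ i, ∀ x ∈ S i, (i, x) ∈ M := fun i x hx => (mem_filter.1 hx).2
    have hsum : (S 0).card + (S 1).card + (S 2).card + (S 3).card = 6 := by
      rw [← hM, card_eq_sum_card_fiberwise (f := Prod.fst) (t := univ) (fun _ _ => by simp),
        Fin.sum_univ_four]
      have : ∀ i, (M.filter fun a => a.1 = i).card = (S i).card := by
        intro i
        rw [← card_image_of_injective (S i) (Prod.mk_right_injective i)]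
        congr 1
        ext ⟨j, x⟩
        simp only [S, mem_filter, mem_image, mem_univ, true_and, Prod.mk.injEq]
        constructor
        · rintro ⟨h, rfl⟩
          exact ⟨x, h, rfl, rfl⟩
        · rintro ⟨y, h, rfl, rfl⟩
          exact ⟨h, rfl⟩
      simp only [this]
    have key : ∀ i j s, J i j s ⊆ Bs → i ≠ j → ∀ P R, P ⊆ S i → R ⊆ S j →
        4 ≤ P.card + R.card → Joins s P R → ∃ B ∈ Bs, 4 ≤ (M ∩ B).card := by
      rintro i j s hs hij P R hP hR h4 ⟨B, hB, h1, h2⟩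
      exact ⟨_, hs (mem_image_of_mem _ hB), four_le_card_inter hij
        (fun x hx => hS i x (hP hx)) (fun x hx => hS j x (hR hx)) h4 h1 h2⟩
    have keyI : ∀ i s m, I i s ⊆ Bs → IsCover univ s 5 4 m → m ≤ (S i).card →
        ∃ B ∈ Bs, 4 ≤ (M ∩ B).card := by
      intro i s m hs hc hm
      obtain ⟨N, hN, hNc⟩ := exists_subset_card_eq hm
      obtain ⟨B, hB, h4⟩ := hc.2 N (subset_univ _) hNc
      exact ⟨_, hs (mem_image_of_mem _ hB), le_card_inter_image (fun x hx => hS i x (hN hx)) h4⟩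
    have k01 := key 0 1 E (fun _ h => by simp only [Bs, mem_union]; tauto) (by decide)
    have k30 := key 3 0 E (fun _ h => by simp only [Bs, mem_union]; tauto) (by decide)
    have k02 := key 0 2 F (fun _ h => by simp only [Bs, mem_union]; tauto) (by decide)
    have k13 := key 1 3 F (fun _ h => by simp only [Bs, mem_union]; tauto) (by decide)
    have k12 := key 1 2 F' (fun _ h => by simp only [Bs, mem_union]; tauto) (by decide)
    have k23 := key 2 3 F' (fun _ h => by simp only [Bs, mem_union]; tauto) (by decide)
    have kg0 := keyI 0 g 4 (fun _ h => by simp only [Bs, mem_union]; tauto) hg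
    have kg1 := keyI 1 g 4 (fun _ h => by simp only [Bs, mem_union]; tauto) hg
    have kb2 := keyI 2 b 5 (fun _ h => by simp only [Bs, mem_union]; tauto) hb
    have kb3 := keyI 3 b 5 (fun _ h => by simp only [Bs, mem_union]; tauto) hb
    have pair : ∀ i j s, JoinsPairs s → (∀ P R, P ⊆ S i → R ⊆ S j →
        4 ≤ P.card + R.card → Joins s P R → ∃ B ∈ Bs, 4 ≤ (M ∩ B).card) →
        2 ≤ (S i).card → 2 ≤ (S j).card → ∃ B ∈ Bs, 4 ≤ (M ∩ B).card := by
      intro i j s hs hk hi hj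
      obtain ⟨P, hP, hPc⟩ := exists_subset_card_eq hi
      obtain ⟨R, hR, hRc⟩ := exists_subset_card_eq hj
      exact hk P R hP hR (by omega) (hs.joins P R hPc hRc)
    have p01 := pair _ _ _ hE k01
    have p30 := pair _ _ _ hE k30
    have p02 := pair _ _ _ hF k02
    have p13 := pair _ _ _ hF k13
    have p12 := pair _ _ _ hF' k12
    have p23 := pair _ _ _ hF' k23
    by_contra hcon
    have q0 : (S 0).card < 4 := by by_contra! h; exact hcon (kg0 h)
    have q1 : (S 1).card < 4 := by by_contra! h; exact hcon (kg1 h)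
    have q2 : (S 2).card < 5 := by by_contra! h; exact hcon (kb2 h)
    have q3 : (S 3).card < 5 := by by_contra! h; exact hcon (kb3 h)
    have point : ∀ i, 1 ≤ (S i).card → ∃ x, {x} ⊆ S i := by
      intro i hi
      obtain ⟨x, hx⟩ := card_pos.1 hi
      exact ⟨x, by simpa using hx⟩
    have four : ∀ i j s, (∀ P R, P ⊆ S i → R ⊆ S j →
        4 ≤ P.card + R.card → Joins s P R → ∃ B ∈ Bs, 4 ≤ (M ∩ B).card) →
        (∀ Q : Finset V, Q.card = 4 → ∀ x, ∃ t ⊆ Q, t.card = 3 ∧ Joins s {x} t) →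
        ¬ (1 ≤ (S i).card ∧ 4 ≤ (S j).card) := by
      rintro i j s hk hq ⟨hi, hj⟩
      obtain ⟨x, hx⟩ := point i hi
      obtain ⟨Q, hQS, hQc⟩ := exists_subset_card_eq hj
      obtain ⟨t, ht, htc, hj⟩ := hq Q hQc x
      exact hcon (hk _ _ hx (ht.trans hQS) (by simp [htc]) hj)
    have f02 := four _ _ _ k02 hQ
    have f12 := four _ _ _ k12 hQ'
    have f13 := four _ _ _ k13 hQ
    have f23 := four _ _ _ k23 hQ'
    have n01 : ¬ (2 ≤ (S 0).card ∧ 2 ≤ (S 1).card) := fun h => hcon (p01 h.1 h.2)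
    have n30 : ¬ (2 ≤ (S 3).card ∧ 2 ≤ (S 0).card) := fun h => hcon (p30 h.1 h.2)
    have n02 : ¬ (2 ≤ (S 0).card ∧ 2 ≤ (S 2).card) := fun h => hcon (p02 h.1 h.2)
    have n13 : ¬ (2 ≤ (S 1).card ∧ 2 ≤ (S 3).card) := fun h => hcon (p13 h.1 h.2)
    have n12 : ¬ (2 ≤ (S 1).card ∧ 2 ≤ (S 2).card) := fun h => hcon (p12 h.1 h.2)
    have n23 : ¬ (2 ≤ (S 2).card ∧ 2 ≤ (S 3).card) := fun h => hcon (p23 h.1 h.2)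
    obtain ⟨i, hi, hj⟩ : ∃ i, (S i).card = 3 ∧ ∀ j, 1 ≤ (S j).card := by
      have : ((S 0).card = 3 ∨ (S 1).card = 3 ∨ (S 2).card = 3 ∨ (S 3).card = 3) ∧
        1 ≤ (S 0).card ∧ 1 ≤ (S 1).card ∧ 1 ≤ (S 2).card ∧ 1 ≤ (S 3).card := by omega
      obtain ⟨h | h | h | h, h0, h1, h2, h3⟩ := this
      · exact ⟨0, h, fun j => by fin_cases j <;> assumption⟩
      · exact ⟨1, h, fun j => by fin_cases j <;> assumption⟩
      · exact ⟨2, h, fun j => by fin_cases j <;> assumption⟩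
      · exact ⟨3, h, fun j => by fin_cases j <;> assumption⟩
    obtain ⟨x0, hx0⟩ := point 0 (hj 0)
    obtain ⟨x1, hx1⟩ := point 1 (hj 1)
    obtain ⟨x2, hx2⟩ := point 2 (hj 2)
    obtain ⟨x3, hx3⟩ := point 3 (hj 3)
    have l4 : ∀ x : V, 4 ≤ ({x} : Finset V).card + (S i).card := fun x => by
      rw [card_singleton, hi]
    have r4 : ∀ x : V, 4 ≤ (S i).card + ({x} : Finset V).card := fun x => by
      rw [card_singleton, hi]
    refine hcon ?_
    fin_cases i
    · rcases hgood _ hi with h | h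
      · exact k30 _ _ hx3 subset_rfl (l4 x3) (h x3)
      · exact k02 _ _ subset_rfl hx2 (r4 x2) (h x2)
    · rcases hgood _ hi with h | h
      · exact k01 _ _ hx0 subset_rfl (l4 x0) (h x0)
      · exact k13 _ _ subset_rfl hx3 (r4 x3) (h x3)
    · rcases hbad _ hi with h | h
      · exact k02 _ _ hx0 subset_rfl (l4 x0) (h x0)
      · exact k12 _ _ hx1 subset_rfl (l4 x1) (h x1)
    · rcases hbad _ hi with h | h
      · exact k13 _ _ hx1 subset_rfl (l4 x1) (h x1)
      · exact k23 _ _ hx2 subset_rfl (l4 x2) (h x2)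

end Assembly

section Factorization

theorem two_mul_card_image_le {ι β : Type*} [DecidableEq ι] [DecidableEq β] {S : Finset ι}
    {f : ι → β} (σ : ι → ι) (hS : ∀ a ∈ S, σ a ∈ S) (hne : ∀ a ∈ S, σ a ≠ a)
    (hf : ∀ a ∈ S, f (σ a) = f a) : 2 * (S.image f).card ≤ S.card := by
  refine mul_card_image_le_card S 2 fun b hb => ?_
  obtain ⟨a, ha, rfl⟩ := mem_image.1 hb
  rw [← card_pair (hne a ha).symm]
  refine card_le_card fun x hx => ?_
  rcases mem_insert.1 hx with rfl | hx
  · simpa using ha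
  · rw [mem_singleton.1 hx]
    simpa using ⟨hS a ha, hf a ha⟩

/-- A family of fixed-point-free involutions such that any two points are exchanged by one
of them; equivalently, a cover of the complete graph by perfect matchings. -/
structure MatchingCover (C α : Type*) where
  mate : C → α → α
  mate_mate : ∀ c x, mate c (mate c x) = x
  mate_ne : ∀ c x, mate c x ≠ x
  exists_mate : ∀ x y, x ≠ y → ∃ c, mate c x = y

theorem exists_matchingCover_option {n : ℕ} (hn : Odd n) :
    Nonempty (MatchingCover (ZMod n) (Option (ZMod n))) := by
  have h2 : IsUnit (2 : ZMod n) := by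
    have := (ZMod.isUnit_iff_coprime 2 n).2 (Nat.coprime_two_left.2 hn)
    exact_mod_cast this
  obtain ⟨u, hu⟩ := h2.exists_right_inv
  refine ⟨⟨fun c x => x.elim (some c) fun y => if y = c then none else some (2 * c - y),
    ?_, ?_, ?_⟩⟩
  · rintro c (_ | x)
    · simp
    · by_cases hx : x = c
      · simp [hx]
      · have : 2 * c - x ≠ c := fun h => hx (by linear_combination -h)
        simp [hx, this]
  · rintro c (_ | x)
    · simp
    · by_cases hx : x = c
      · simp [hx]
      · simp only [Option.elim_some, if_neg hx, ne_eq, Option.some.injEq]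
        intro h
        exact hx (by linear_combination (-u) * h + (c - x) * hu)
  · rintro (_ | x) (_ | y) hxy
    · exact absurd rfl hxy
    · exact ⟨y, by simp⟩
    · exact ⟨x, by simp⟩
    · have hne : x ≠ y := fun h => hxy (congrArg some h)
      refine ⟨u * (x + y), ?_⟩
      have : x ≠ u * (x + y) := fun h => hne (by linear_combination 2 * h + (x + y) * hu)
      simp only [Option.elim_some, if_neg this, Option.some.injEq]
      linear_combination (x + y) * hu

theorem exists_matchingCover {C α : Type*} [Fintype C] [Fintype α] (hC : Odd (Fintype.card C))
    (h : Fintype.card α = Fintype.card C + 1) : Nonempty (MatchingCover C α) := by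
  obtain ⟨m⟩ := exists_matchingCover_option hC
  have : NeZero (Fintype.card C) := ⟨hC.pos.ne'⟩
  let e : C ≃ ZMod (Fintype.card C) := Fintype.equivOfCardEq (by simp)
  let f : α ≃ Option (ZMod (Fintype.card C)) := Fintype.equivOfCardEq (by simp [h])
  refine ⟨⟨fun c x => f.symm (m.mate (e c) (f x)), fun c x => by simp [m.mate_mate],
    fun c x hx => m.mate_ne (e c) (f x) ?_, fun x y hxy => ?_⟩⟩
  · rwa [Equiv.symm_apply_eq] at hx
  · obtain ⟨c, hc⟩ := m.exists_mate (f x) (f y) (f.injective.ne hxy)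
    exact ⟨e.symm c, by simp [hc]⟩

variable {V : Type*} [DecidableEq V]

/-- `t` lies in a member of the family `U`. -/
def Covered (U : Finset (Finset V)) (t : Finset V) : Prop := ∃ b ∈ U, t ⊆ b

/-- A family of sets of size at most three covering all pairs. -/
structure PairCover (U : Finset (Finset V)) : Prop where
  card_le : ∀ t ∈ U, t.card ≤ 3
  covers : ∀ x y, x ≠ y → Covered U {x, y}

theorem exists_joinsPairs {I : Type*} [Fintype I] [Fintype V] (hI : Odd (Fintype.card I))
    (hV : Fintype.card V = Fintype.card I + 1) {w : ℕ} (hw : Fintype.card V = 2 * w)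
    {U : I → Finset (Finset V)} (hU : ∀ i, PairCover (U i)) :
    ∃ E : Finset (Finset V × Finset V), JoinsPairs E ∧
      (∀ i t, Covered (U i) t → ∀ x, Joins E {x} t) ∧ E.card ≤ w * ∑ i, (U i).card := by
  obtain ⟨m⟩ := exists_matchingCover hI hV
  let P : I → Finset (Finset V) := fun i => univ.image fun x => {x, m.mate i x}
  have hP : ∀ i, (P i).card ≤ w := by
    intro i
    have := two_mul_card_image_le (S := univ) (f := fun x => ({x, m.mate i x} : Finset V))
      (m.mate i) (fun _ _ => mem_univ _) (fun x _ => m.mate_ne i x)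
      (fun x _ => by rw [m.mate_mate, pair_comm])
    rw [card_univ, hw] at this
    change (univ.image fun x => ({x, m.mate i x} : Finset V)).card ≤ w
    omega
  have hmem : ∀ i x q, q ∈ U i → (({x, m.mate i x} : Finset V), q) ∈
      univ.biUnion fun i => P i ×ˢ U i := fun i x q hq =>
    mem_biUnion.2 ⟨i, mem_univ _, mem_product.2 ⟨mem_image_of_mem _ (mem_univ _), hq⟩⟩
  refine ⟨univ.biUnion fun i => P i ×ˢ U i, ⟨?_, ?_⟩, ?_, ?_⟩
  · intro b hb
    obtain ⟨i, -, hb⟩ := mem_biUnion.1 hb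
    obtain ⟨h1, h2⟩ := mem_product.1 hb
    obtain ⟨x, -, hx⟩ := mem_image.1 h1
    have h3 : b.1.card ≤ 2 := hx ▸ card_le_two
    have := (hU i).card_le _ h2
    omega
  · intro p q hp hq
    obtain ⟨x, y, hxy, rfl⟩ := card_eq_two.1 hp
    obtain ⟨z, z', hz, rfl⟩ := card_eq_two.1 hq
    obtain ⟨i, rfl⟩ := m.exists_mate x y hxy
    obtain ⟨t, ht, hs⟩ := (hU i).covers z z' hz
    exact ⟨_, hmem i x t ht, subset_rfl, hs⟩
  · rintro i t ⟨b, hb, htb⟩ x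
    exact ⟨_, hmem i x b hb, by simp, htb⟩
  · rw [mul_sum]
    refine card_biUnion_le.trans (sum_le_sum fun i _ => ?_)
    rw [card_product]
    exact Nat.mul_le_mul_right _ (hP i)

end Factorization

section Mixed

variable {G : Type*} [DecidableEq G]

/-- The copy of `t` in column `i` of `G × Bool`. -/
def col (i : Bool) (t : Finset G) : Finset (G × Bool) := t.image fun x => (x, i)

theorem card_col (i : Bool) (t : Finset G) : (col i t).card = t.card :=
  card_image_of_injective _ fun _ _ h => congrArg Prod.fst h

theorem col_mono (i : Bool) {s t : Finset G} (h : s ⊆ t) : col i s ⊆ col i t :=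
  image_subset_image h

@[simp] theorem col_pair (i : Bool) (x y : G) : col i {x, y} = {(x, i), (y, i)} := by
  simp [col, image_insert]

@[simp] theorem mem_col {i : Bool} {t : Finset G} {a : G × Bool} :
    a ∈ col i t ↔ a.1 ∈ t ∧ a.2 = i := by
  rcases a with ⟨x, j⟩
  simp only [col, mem_image, Prod.mk.injEq]
  constructor
  · rintro ⟨y, hy, rfl, rfl⟩
    exact ⟨hy, rfl⟩
  · rintro ⟨hx, rfl⟩
    exact ⟨x, hx, rfl, rfl⟩

theorem Covered.mono {V : Type*} [DecidableEq V] {U U' : Finset (Finset V)} {t t' : Finset V}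
    (h : Covered U t) (hU : U ⊆ U') (ht : t' ⊆ t) : Covered U' t' := by
  obtain ⟨b, hb, htb⟩ := h
  exact ⟨b, hU hb, ht.trans htb⟩

theorem Joins.mono {V : Type*} [DecidableEq V] {E E' : Finset (Finset V × Finset V)}
    {p q p' q' : Finset V} (h : Joins E p q) (hE : E ⊆ E') (hp : p' ⊆ p) (hq : q' ⊆ q) :
    Joins E' p' q' := by
  obtain ⟨b, hb, h1, h2⟩ := h
  exact ⟨b, hE hb, hp.trans h1, hq.trans h2⟩

theorem Covered.col {U : Finset (Finset G)} {t : Finset G} (h : Covered U t) (i : Bool) :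
    Covered (U.image (_root_.col i)) (_root_.col i t) := by
  obtain ⟨b, hb, htb⟩ := h
  exact ⟨_, mem_image_of_mem _ hb, col_mono i htb⟩

variable [Fintype G] [AddCommGroup G]

/-- The three-element subsets with sum `s`. -/
def sumTriples (s : G) : Finset (Finset G) := (powersetCard 3 univ).filter fun t => ∑ x ∈ t, x = s

theorem mem_sumTriples {s : G} {t : Finset G} :
    t ∈ sumTriples s ↔ t.card = 3 ∧ ∑ x ∈ t, x = s := by
  simp [sumTriples, mem_powersetCard]

/-- Triples covering all pairs of `G × Bool` other than the pairs `{(x, true), (x + x, false)}`. -/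
def wedge (K : G → Finset (Finset G)) (s : G) : Finset (Finset (G × Bool)) :=
  (univ.offDiag.image fun p : G × G => {(p.1, true), (p.2, true), (p.1 + p.2, false)}) ∪
    (K s).image (col false)

theorem two_mul_card_wedge_le (K : G → Finset (Finset G)) (s : G) :
    2 * (wedge K s).card ≤ (Fintype.card G * Fintype.card G - Fintype.card G) +
      2 * (K s).card := by
  have h1 := two_mul_card_image_le (S := (univ : Finset G).offDiag)
    (f := fun p : G × G => ({(p.1, true), (p.2, true), (p.1 + p.2, false)} : Finset (G × Bool)))
    Prod.swap (fun a ha => by simpa [eq_comm] using ha)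
    (fun a ha h => by simp only [mem_offDiag] at ha; exact ha.2.2 (congrArg Prod.snd h))
    (fun a _ => by simp only [Prod.fst_swap, Prod.snd_swap, add_comm]; rw [insert_comm])
  rw [offDiag_card, card_univ] at h1
  have h2 : ((K s).image (col false)).card ≤ (K s).card := card_image_le
  have h3 := card_union_le (univ.offDiag.image fun p : G × G =>
    ({(p.1, true), (p.2, true), (p.1 + p.2, false)} : Finset (G × Bool))) ((K s).image (col false))
  unfold wedge
  omega

theorem card_le_of_mem_wedge {K : G → Finset (Finset G)} {s : G} (hK : PairCover (K s))
    {t : Finset (G × Bool)} (ht : t ∈ wedge K s) : t.card ≤ 3 := by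
  rcases mem_union.1 ht with ht | ht <;> obtain ⟨p, hp, rfl⟩ := mem_image.1 ht
  · exact card_le_three
  · rw [card_col]; exact hK.card_le _ hp

theorem covered_wedge {K : G → Finset (Finset G)} {s : G} (hK : PairCover (K s))
    {a b : G × Bool} (hab : a ≠ b) : Covered (wedge K s) {a, b} ∨
      ∃ x : G, ({a, b} : Finset (G × Bool)) = {(x, true), (x + x, false)} := by
  have key : ∀ x y : G, Covered (wedge K s) {(x, true), (y, false)} ∨
      ∃ z : G, ({(x, true), (y, false)} : Finset (G × Bool)) = {(z, true), (z + z, false)} := by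
    intro x y
    by_cases h : y - x = x
    · right
      exact ⟨x, by rw [sub_eq_iff_eq_add.1 h]⟩
    · left
      refine ⟨{(x, true), (y - x, true), (x + (y - x), false)}, mem_union_left _
        (mem_image.2 ⟨(x, y - x), by simpa [eq_comm] using h, rfl⟩), ?_⟩
      intro z hz
      simp only [mem_insert, mem_singleton, add_sub_cancel] at hz ⊢
      tauto
  rcases a with ⟨x, _ | _⟩ <;> rcases b with ⟨y, _ | _⟩
  · left
    have hxy : x ≠ y := fun h => hab (by rw [h])
    have := ((hK.covers x y hxy).col false).mono (subset_union_right (s₁ :=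
      (univ.offDiag.image fun p : G × G => {(p.1, true), (p.2, true), (p.1 + p.2, false)})))
      subset_rfl
    simpa [wedge] using this
  · rw [pair_comm]; exact key y x
  · exact key x y
  · left
    have hxy : x ≠ y := fun h => hab (by rw [h])
    exact ⟨_, mem_union_left _ (mem_image.2 ⟨(x, y), by simpa using hxy, rfl⟩), fun z hz => by
      simp only [mem_insert, mem_singleton] at hz ⊢; tauto⟩

/-- The blocks joining a pair `{(x, i), (y, i)}` inside a column to the members of `D (x + y)`. -/
def columnBlocks (D : G → Finset (Finset (G × Bool))) :
    Finset (Finset (G × Bool) × Finset (G × Bool)) :=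
  (((univ : Finset G).offDiag ×ˢ (univ : Finset Bool)).sigma fun q => D (q.1.1 + q.1.2)).image
    fun q => ({(q.1.1.1, q.1.2), (q.1.1.2, q.1.2)}, q.2)

theorem mem_columnBlocks {D : G → Finset (Finset (G × Bool))}
    {b : Finset (G × Bool) × Finset (G × Bool)} : b ∈ columnBlocks D ↔
      ∃ x y i t, x ≠ y ∧ t ∈ D (x + y) ∧ (({(x, i), (y, i)} : Finset (G × Bool)), t) = b := by
  simp only [columnBlocks, mem_image, mem_sigma, mem_product, mem_offDiag, mem_univ, true_and,
    and_true]
  constructor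
  · rintro ⟨⟨⟨⟨x, y⟩, i⟩, t⟩, ⟨h1, h2⟩, h3⟩
    exact ⟨x, y, i, t, h1, h2, h3⟩
  · rintro ⟨x, y, i, t, h1, h2, h3⟩
    exact ⟨⟨⟨⟨x, y⟩, i⟩, t⟩, ⟨h1, h2⟩, h3⟩

theorem card_columnBlocks_le (D : G → Finset (Finset (G × Bool))) :
    (columnBlocks D).card ≤ ∑ p ∈ univ.offDiag, (D (p.1 + p.2)).card := by
  suffices 2 * (columnBlocks D).card ≤ 2 * ∑ p ∈ univ.offDiag, (D (p.1 + p.2)).card by omega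
  refine (two_mul_card_image_le (fun q => ⟨(q.1.1.swap, q.1.2), q.2⟩) ?_ ?_ ?_).trans
    (le_of_eq ?_)
  · rintro ⟨⟨⟨x, y⟩, i⟩, t⟩ h
    simp only [mem_sigma, mem_product, mem_offDiag, mem_univ, true_and, and_true,
      Prod.fst_swap, Prod.snd_swap] at h ⊢
    exact ⟨fun hh => h.1 hh.symm, by rw [add_comm]; exact h.2⟩
  · rintro ⟨⟨⟨x, y⟩, i⟩, t⟩ h hh
    simp only [mem_sigma, mem_product, mem_offDiag, mem_univ, true_and, and_true] at h
    simp only [Prod.swap, Sigma.mk.injEq, Prod.mk.injEq] at hh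
    exact h.1 hh.1.1.2
  · rintro ⟨⟨⟨x, y⟩, i⟩, t⟩ h
    simp only [Prod.swap, Prod.mk.injEq, and_true]
    rw [pair_comm]
  · rw [card_sigma, sum_product, mul_sum]
    simp

/-- The blocks joining a pair `{(x, false), (y, true)}` to the members of `A (y - x)`. -/
def crossBlocks (A : G → Finset (Finset (G × Bool))) :
    Finset (Finset (G × Bool) × Finset (G × Bool)) :=
  (univ : Finset (G × G)).biUnion fun p => {{(p.1, false), (p.2, true)}} ×ˢ A (p.2 - p.1)

theorem card_crossBlocks_le (A : G → Finset (Finset (G × Bool))) :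
    (crossBlocks A).card ≤ Fintype.card G * ∑ s, (A s).card := by
  refine card_biUnion_le.trans (le_of_eq ?_)
  simp only [card_product, card_singleton, one_mul]
  rw [← univ_product_univ, sum_product]
  have : ∀ x : G, ∑ y, (A (y - x)).card = ∑ s, (A s).card := fun x =>
    Equiv.sum_comp (Equiv.subRight x) fun s => (A s).card
  simp [this]

theorem exists_mixed {A : G → Finset (Finset (G × Bool))} {K : G → Finset (Finset G)}
    (hA : ∀ s, PairCover (A s)) (hK : ∀ s, PairCover (K s)) (hT : ∀ s, sumTriples s ⊆ K s)
    (s₀ : G) {Z : Finset (Finset G)} (hZ : ∀ e ∈ Z, e.card ≤ 2)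
    (hZc : ∀ y, (∃ x, y = x + x) ∨ ∃ e ∈ Z, y ∈ e) :
    ∃ F : Finset (Finset (G × Bool) × Finset (G × Bool)), JoinsPairs F ∧
      (∀ s t, Covered (A s) t → ∀ x, Joins F {x} t) ∧
      (∀ t ∈ sumTriples s₀, ∀ y, Joins F (col false t) {y}) ∧
      (∀ t : Finset G, t.card = 3 → ∀ x i, ∑ y ∈ t, y ≠ x + x → Joins F {(x, i)} (col false t)) ∧
      F.card ≤ Fintype.card G * ∑ s, (A s).card +
        ∑ p ∈ univ.offDiag, (wedge K (p.1 + p.2)).card + 2 * Fintype.card G * (K s₀).card +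
        Z.card * (sumTriples s₀).card := by
  let F₁ : Finset (Finset (G × Bool) × Finset (G × Bool)) := crossBlocks A
  let F₂ : Finset (Finset (G × Bool) × Finset (G × Bool)) := columnBlocks (wedge K)
  let F₃ : Finset (Finset (G × Bool) × Finset (G × Bool)) :=
    ((K s₀).image (col false) ∪ (K s₀).image (col true)) ×ˢ
      univ.image fun x : G => {(x, true), (x + x, false)}
  let F₄ : Finset (Finset (G × Bool) × Finset (G × Bool)) :=
    (sumTriples s₀).image (col false) ×ˢ Z.image (col false)
  have m₁ : ∀ x y t, t ∈ A (y - x) → (({(x, false), (y, true)} : Finset (G × Bool)), t) ∈ F₁ :=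
    fun x y t ht => mem_biUnion.2 ⟨(x, y), mem_univ _, by simpa using ht⟩
  have m₂ : ∀ x y i t, x ≠ y → t ∈ wedge K (x + y) →
      (({(x, i), (y, i)} : Finset (G × Bool)), t) ∈ F₂ :=
    fun x y i t hxy ht => mem_columnBlocks.2 ⟨x, y, i, t, hxy, ht, rfl⟩
  have m₃ : ∀ x t i, t ∈ K s₀ →
      (col i t, ({(x, true), (x + x, false)} : Finset (G × Bool))) ∈ F₃ := by
    intro x t i ht
    refine mem_product.2 ⟨?_, mem_image_of_mem _ (mem_univ _)⟩
    cases i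
    · exact mem_union_left _ (mem_image_of_mem _ ht)
    · exact mem_union_right _ (mem_image_of_mem _ ht)
  have s₁ : F₁ ⊆ F₁ ∪ F₂ ∪ F₃ ∪ F₄ := fun _ h => by simp only [mem_union]; tauto
  have s₂ : F₂ ⊆ F₁ ∪ F₂ ∪ F₃ ∪ F₄ := fun _ h => by simp only [mem_union]; tauto
  have s₃ : F₃ ⊆ F₁ ∪ F₂ ∪ F₃ ∪ F₄ := fun _ h => by simp only [mem_union]; tauto
  have s₄ : F₄ ⊆ F₁ ∪ F₂ ∪ F₃ ∪ F₄ := fun _ h => by simp only [mem_union]; tauto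
  have jcross : ∀ x y a b, a ≠ b → Joins F₁ {(x, false), (y, true)} {a, b} := by
    intro x y a b hab
    obtain ⟨t, ht, hs⟩ := (hA (y - x)).covers a b hab
    exact ⟨_, m₁ x y t ht, subset_rfl, hs⟩
  have jcol : ∀ x y i a b, x ≠ y → a ≠ b →
      Joins (F₁ ∪ F₂ ∪ F₃ ∪ F₄) {(x, i), (y, i)} {a, b} := by
    intro x y i a b hxy hab
    rcases covered_wedge (hK (x + y)) hab with ⟨t, ht, hs⟩ | ⟨z, hz⟩
    · exact Joins.mono ⟨_, m₂ x y i t hxy ht, subset_rfl, hs⟩ s₂ subset_rfl subset_rfl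
    · obtain ⟨t, ht, hs⟩ := (hK s₀).covers x y hxy
      refine Joins.mono ⟨_, m₃ z t i ht, ?_, hz.subset⟩ s₃ subset_rfl subset_rfl
      simpa using col_mono i hs
  refine ⟨F₁ ∪ F₂ ∪ F₃ ∪ F₄, ⟨?_, ?_⟩, ?_, ?_, ?_, ?_⟩
  · intro b hb
    simp only [mem_union] at hb
    rcases hb with ((hb | hb) | hb) | hb
    · obtain ⟨p, -, hb⟩ := mem_biUnion.1 hb
      obtain ⟨h1, h2⟩ := mem_product.1 hb
      have h3 : b.1.card ≤ 2 := mem_singleton.1 h1 ▸ card_le_two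
      have := (hA _).card_le _ h2
      omega
    · obtain ⟨x, y, i, t, -, ht, rfl⟩ := mem_columnBlocks.1 hb
      exact add_le_add card_le_two (card_le_of_mem_wedge (hK _) ht)
    · obtain ⟨h1, h2⟩ := mem_product.1 hb
      obtain ⟨x, -, hx⟩ := mem_image.1 h2
      have h3 : b.2.card ≤ 2 := hx ▸ card_le_two
      have h4 : b.1.card ≤ 3 := by
        rcases mem_union.1 h1 with h1 | h1 <;> obtain ⟨t, ht, h⟩ := mem_image.1 h1 <;>
          rw [← h, card_col] <;> exact (hK s₀).card_le _ ht
      omega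
    · obtain ⟨h1, h2⟩ := mem_product.1 hb
      obtain ⟨t, ht, h⟩ := mem_image.1 h1
      obtain ⟨e, he, h'⟩ := mem_image.1 h2
      rw [← h, ← h', card_col, card_col, (mem_sumTriples.1 ht).1]
      have := hZ e he
      omega
  · intro p q hp hq
    obtain ⟨⟨x, i⟩, ⟨y, j⟩, hxy, rfl⟩ := card_eq_two.1 hp
    obtain ⟨a, b, hab, rfl⟩ := card_eq_two.1 hq
    rcases i with _ | _ <;> rcases j with _ | _
    · exact jcol x y _ a b (fun h => hxy (by rw [h])) hab
    · exact (jcross x y a b hab).mono s₁ subset_rfl subset_rfl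
    · rw [pair_comm]
      exact (jcross y x a b hab).mono s₁ subset_rfl subset_rfl
    · exact jcol x y _ a b (fun h => hxy (by rw [h])) hab
  · rintro s t ⟨b, hb, htb⟩ ⟨x, _ | _⟩
    · exact Joins.mono ⟨_, m₁ x (x + s) b (by simpa using hb), subset_rfl, htb⟩ s₁
        (by simp) subset_rfl
    · exact Joins.mono ⟨_, m₁ (x - s) x b (by simpa using hb), subset_rfl, htb⟩ s₁
        (by simp) subset_rfl
  · intro t ht
    have h3 : ∀ x, Joins (F₁ ∪ F₂ ∪ F₃ ∪ F₄) (col false t) {(x, true), (x + x, false)} :=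
      fun x => Joins.mono ⟨_, m₃ x t false (hT s₀ ht), subset_rfl, subset_rfl⟩ s₃
        subset_rfl subset_rfl
    rintro ⟨y, _ | _⟩
    · rcases hZc y with ⟨x, rfl⟩ | ⟨e, he, hy⟩
      · exact (h3 x).mono subset_rfl subset_rfl (by simp)
      · have h4 : (col false t, col false e) ∈ F₄ :=
          mem_product.2 ⟨mem_image_of_mem (col false) ht, mem_image_of_mem (col false) he⟩
        exact Joins.mono ⟨_, h4, subset_rfl, subset_rfl⟩ s₄ subset_rfl (by simpa using hy)
    · exact (h3 y).mono subset_rfl subset_rfl (by simp)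
  · intro t ht x i hx
    have hne : x ≠ ∑ y ∈ t, y - x := fun h => hx (by rw [eq_sub_iff_add_eq] at h; exact h.symm)
    refine Joins.mono ⟨_, m₂ x (∑ y ∈ t, y - x) i (col false t) hne ?_, subset_rfl, subset_rfl⟩ s₂
      (by simp) subset_rfl
    rw [add_sub_cancel]
    exact mem_union_right _ (mem_image_of_mem _ (hT _ (mem_sumTriples.2 ⟨ht, rfl⟩)))
  · have c₁ : F₁.card ≤ Fintype.card G * ∑ s, (A s).card := card_crossBlocks_le A
    have c₂ : F₂.card ≤ ∑ p ∈ univ.offDiag, (wedge K (p.1 + p.2)).card := card_columnBlocks_le _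
    have c₃ : F₃.card ≤ 2 * Fintype.card G * (K s₀).card := by
      rw [card_product, mul_assoc, mul_left_comm, mul_comm]
      refine Nat.mul_le_mul (card_image_le.trans_eq card_univ) ?_
      refine (card_union_le _ _).trans ?_
      rw [two_mul]
      exact add_le_add card_image_le card_image_le
    have c₄ : F₄.card ≤ Z.card * (sumTriples s₀).card := by
      rw [card_product, mul_comm]
      exact Nat.mul_le_mul card_image_le card_image_le
    have u₁ := card_union_le (F₁ ∪ F₂ ∪ F₃) F₄
    have u₂ := card_union_le (F₁ ∪ F₂) F₃
    have u₃ := card_union_le F₁ F₂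
    omega

end Mixed

section Flip

variable {G : Type*}

/-- Exchange the two columns. -/
def flipCol : G × Bool ≃ G × Bool := (Equiv.refl G).prodCongr Equiv.boolNot

@[simp] theorem flipCol_apply (x : G) (i : Bool) : flipCol (x, i) = (x, !i) := rfl

theorem map_flipCol_map_flipCol (u : Finset (G × Bool)) :
    (u.map flipCol.toEmbedding).map flipCol.toEmbedding = u := by
  rw [map_map]
  ext ⟨x, i⟩
  simp only [mem_map, Function.Embedding.trans_apply, Equiv.coe_toEmbedding]
  constructor
  · rintro ⟨⟨y, j⟩, hy, h⟩
    simp only [flipCol_apply, Bool.not_not] at h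
    rwa [← h]
  · intro h
    exact ⟨_, h, by simp⟩

end Flip

section Core

variable {G : Type*} [DecidableEq G]

theorem triple_cases {t : Finset (G × Bool)} (ht : t.card = 3) :
    (∃ x y z, x ≠ y ∧ t = {(x, false), (y, false), (z, true)}) ∨
    (∃ x y z, x ≠ y ∧ t = {(x, true), (y, true), (z, false)}) ∨
    ∃ i, ∃ u : Finset G, u.card = 3 ∧ t = col i u := by
  have hcol : ∀ i (x y z : G), ({(x, i), (y, i), (z, i)} : Finset (G × Bool)) = t →
      ∃ i, ∃ u : Finset G, u.card = 3 ∧ t = col i u := by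
    rintro i x y z rfl
    have : ({(x, i), (y, i), (z, i)} : Finset (G × Bool)) = col i {x, y, z} := by
      simp [col, image_insert]
    exact ⟨i, {x, y, z}, by rw [← card_col i, ← this, ht], this⟩
  obtain ⟨⟨x, i⟩, ⟨y, j⟩, ⟨z, k⟩, h1, h2, h3, rfl⟩ := card_eq_three.1 ht
  rcases i with _ | _ <;> rcases j with _ | _ <;> rcases k with _ | _
  · exact .inr (.inr (hcol _ x y z rfl))
  · exact .inl ⟨x, y, z, fun h => h1 (by rw [h]), rfl⟩
  · exact .inl ⟨x, z, y, fun h => h2 (by rw [h]), by ext; simp only [mem_insert, mem_singleton]; tauto⟩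
  · exact .inr (.inl ⟨y, z, x, fun h => h3 (by rw [h]),
      by ext; simp only [mem_insert, mem_singleton]; tauto⟩)
  · exact .inl ⟨y, z, x, fun h => h3 (by rw [h]),
      by ext; simp only [mem_insert, mem_singleton]; tauto⟩
  · exact .inr (.inl ⟨x, z, y, fun h => h2 (by rw [h]),
      by ext; simp only [mem_insert, mem_singleton]; tauto⟩)
  · exact .inr (.inl ⟨x, y, z, fun h => h1 (by rw [h]), rfl⟩)
  · exact .inr (.inr (hcol _ x y z rfl))

theorem quadruple_cases {Q : Finset (G × Bool)} (hQ : Q.card = 4) :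
    (∃ x y z, x ≠ y ∧ ({(x, false), (y, false), (z, true)} : Finset (G × Bool)) ⊆ Q) ∨
    (∃ u : Finset G, u.card = 3 ∧ col true u ⊆ Q) ∨
    ∃ R : Finset G, R.card = 4 ∧ Q = col false R := by
  let S : Bool → Finset G := fun i => (Q.filter fun a => a.2 = i).image Prod.fst
  have hS : ∀ i x, x ∈ S i ↔ (x, i) ∈ Q := by
    intro i x
    simp [S]
  have hQS : Q = col false (S false) ∪ col true (S true) := by
    ext ⟨x, i⟩
    cases i <;> simp [hS]
  have hc : (S false).card + (S true).card = 4 := by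
    rw [← card_col false, ← card_col true (S true), ← card_union_of_disjoint, ← hQS, hQ]
    rw [disjoint_left]
    rintro ⟨x, i⟩ h1 h2
    rw [mem_col] at h1 h2
    exact Bool.false_ne_true (h1.2.symm.trans h2.2)
  rcases Nat.eq_zero_or_pos (S true).card with h0 | h0
  · refine .inr (.inr ⟨S false, by omega, ?_⟩)
    rw [card_eq_zero] at h0
    rw [h0] at hQS
    simpa [col] using hQS
  · by_cases h2 : 2 ≤ (S false).card
    · obtain ⟨x, hx, y, hy, hxy⟩ := one_lt_card.1 h2
      obtain ⟨z, hz⟩ := card_pos.1 h0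
      refine .inl ⟨x, y, z, hxy, ?_⟩
      intro a ha
      simp only [mem_insert, mem_singleton] at ha
      rcases ha with rfl | rfl | rfl
      · exact (hS _ _).1 hx
      · exact (hS _ _).1 hy
      · exact (hS _ _).1 hz
    · obtain ⟨u, hu, huc⟩ := exists_subset_card_eq (s := S true) (n := 3) (by omega)
      refine .inr (.inl ⟨u, huc, fun a ha => ?_⟩)
      rw [mem_col] at ha
      rcases a with ⟨x, i⟩
      obtain ⟨h, rfl⟩ := ha
      exact (hS _ _).1 (hu h)

theorem map_flipCol_col (i : Bool) (u : Finset G) :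
    (col i u).map flipCol.toEmbedding = col (!i) u := by
  ext ⟨x, j⟩
  simp only [col, mem_map, mem_image, Equiv.coe_toEmbedding]
  constructor
  · rintro ⟨_, ⟨y, hy, rfl⟩, h⟩
    exact ⟨y, hy, h⟩
  · rintro ⟨y, hy, h⟩
    exact ⟨_, ⟨y, hy, rfl⟩, h⟩

/-- Exchange the columns in the second part of every block. -/
def flipTarget (F : Finset (Finset (G × Bool) × Finset (G × Bool))) :
    Finset (Finset (G × Bool) × Finset (G × Bool)) :=
  F.image fun b => (b.1, b.2.map flipCol.toEmbedding)

theorem Joins.flipTarget {F : Finset (Finset (G × Bool) × Finset (G × Bool))}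
    {p q : Finset (G × Bool)} (h : Joins F p (q.map flipCol.toEmbedding)) :
    Joins (_root_.flipTarget F) p q := by
  obtain ⟨b, hb, h1, h2⟩ := h
  refine ⟨_, mem_image_of_mem _ hb, h1, ?_⟩
  rw [← map_flipCol_map_flipCol q]
  exact map_subset_map.2 h2

theorem JoinsPairs.flipTarget {F : Finset (Finset (G × Bool) × Finset (G × Bool))}
    (h : JoinsPairs F) : JoinsPairs (_root_.flipTarget F) := by
  refine ⟨fun b hb => ?_, fun p q hp hq => (h.joins p _ hp (by rw [card_map, hq])).flipTarget⟩
  obtain ⟨c, hc, rfl⟩ := mem_image.1 hb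
  rw [card_map]
  exact h.card_le c hc

theorem exists_sum_ne [AddCommGroup G] {R : Finset G} (hR : R.card = 4) (a : G) :
    ∃ t ⊆ R, t.card = 3 ∧ ∑ x ∈ t, x ≠ a := by
  obtain ⟨x, hx, y, hy, hxy⟩ := one_lt_card.1 (by omega : 1 < R.card)
  by_contra! h
  have h1 := h (R.erase x) (erase_subset _ _) (by rw [card_erase_of_mem hx, hR])
  have h2 := h (R.erase y) (erase_subset _ _) (by rw [card_erase_of_mem hy, hR])
  have h3 := add_sum_erase R id hx
  have h4 := add_sum_erase R id hy
  simp only [id] at h3 h4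
  rw [h1, ← h4, h2] at h3
  exact hxy (add_right_cancel h3)

variable [Fintype G] [AddCommGroup G]

theorem coverNumber_le_of_pairCovers (h3 : 3 ≤ Fintype.card G)
    {A B : G → Finset (Finset (G × Bool))} {K : G → Finset (Finset G)} {s₀ : G}
    (hA : ∀ s, PairCover (A s)) (hB : ∀ s, s ≠ s₀ → PairCover (B s))
    (hK : ∀ s, PairCover (K s)) (hT : ∀ s, sumTriples s ⊆ K s)
    {Z : Finset (Finset G)} (hZ : ∀ e ∈ Z, e.card ≤ 2)
    (hZc : ∀ y, (∃ x, y = x + x) ∨ ∃ e ∈ Z, y ∈ e)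
    (hA₁ : ∀ x y z, x ≠ y → ∃ s, Covered (A s) {(x, false), (y, false), (z, true)})
    (hA₃ : ∀ t : Finset G, t.card = 3 → ∃ s, Covered (A s) (col true t))
    (hB₁ : ∀ x y z, x ≠ y → (∃ s, Covered (A s) {(x, true), (y, true), (z, false)}) ∨
      ∃ s, s ≠ s₀ ∧ Covered (B s) {(x, true), (y, true), (z, false)})
    (hB₃ : ∀ t : Finset G, t.card = 3 → ∑ x ∈ t, x ≠ s₀ →
      ∃ s, s ≠ s₀ ∧ Covered (B s) (col false t)) :
    coverNumber (4 * (2 * Fintype.card G)) 5 4 6 ≤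
      2 * (coverNumber (2 * Fintype.card G) 5 4 5 + coverNumber (2 * Fintype.card G) 5 4 4) +
        2 * (Fintype.card G * (∑ s, (A s).card + ∑ s ∈ univ.erase s₀, (B s).card) +
          2 * (Fintype.card G * ∑ s, (A s).card + ∑ p ∈ univ.offDiag, (wedge K (p.1 + p.2)).card +
            2 * Fintype.card G * (K s₀).card + Z.card * (sumTriples s₀).card)) := by
  have hV : Fintype.card (G × Bool) = 2 * Fintype.card G := by simp [mul_comm]
  have hI : Fintype.card (G ⊕ {s // s ≠ s₀}) = 2 * Fintype.card G - 1 := by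
    rw [Fintype.card_sum, Fintype.card_subtype_compl, Fintype.card_subtype_eq]
    omega
  obtain ⟨F, hF, hFA, hFT, hFf, hFc⟩ := exists_mixed hA hK hT s₀ hZ hZc
  obtain ⟨E, hE, hEU, hEc⟩ := exists_joinsPairs (I := G ⊕ {s // s ≠ s₀}) (V := G × Bool)
    (w := Fintype.card G) (by rw [hI]; exact ⟨Fintype.card G - 1, by omega⟩) (by omega) hV
    (U := Sum.elim A fun s => B s.1)
    (by rintro (s | s); exacts [hA s, hB s.1 s.2])
  have hEA : ∀ s t, Covered (A s) t → ∀ x, Joins E {x} t := fun s => hEU (.inl s)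
  have hEB : ∀ s, s ≠ s₀ → ∀ t, Covered (B s) t → ∀ x, Joins E {x} t :=
    fun s hs => hEU (.inr ⟨s, hs⟩)
  have hF₁ : ∀ x y z, x ≠ y → ∀ a, Joins F {a} {(x, false), (y, false), (z, true)} := by
    intro x y z hxy a
    obtain ⟨s, hs⟩ := hA₁ x y z hxy
    exact hFA s _ hs a
  have hF₃ : ∀ t : Finset G, t.card = 3 → ∀ a, Joins F {a} (col true t) := by
    intro t ht a
    obtain ⟨s, hs⟩ := hA₃ t ht
    exact hFA s _ hs a
  have hQ : ∀ Q : Finset (G × Bool), Q.card = 4 → ∀ x, ∃ t ⊆ Q, t.card = 3 ∧ Joins F {x} t := by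
    rintro Q hQ ⟨a, i⟩
    rcases quadruple_cases hQ with ⟨x, y, z, hxy, h⟩ | ⟨u, hu, h⟩ | ⟨R, hR, rfl⟩
    · exact ⟨_, h, card_eq_three.2 ⟨_, _, _, by simpa using hxy, by simp, by simp, rfl⟩,
        hF₁ x y z hxy _⟩
    · exact ⟨_, h, by rw [card_col, hu], hF₃ u hu _⟩
    · obtain ⟨t, ht, htc, hs⟩ := exists_sum_ne hR (a + a)
      exact ⟨_, col_mono _ ht, by rw [card_col, htc], hFf t htc a i hs⟩
  rw [← hV]
  refine (coverNumber_le_of_joins (by omega) hE hF hF.flipTarget ?_ ?_ hQ ?_).trans ?_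
  · intro t ht
    rcases triple_cases ht with ⟨x, y, z, hxy, rfl⟩ | ⟨x, y, z, hxy, rfl⟩ | ⟨_ | _, u, hu, rfl⟩
    · obtain ⟨s, hs⟩ := hA₁ x y z hxy
      exact .inl (hEA s _ hs)
    · obtain ⟨s, hs⟩ | ⟨s, hs, h⟩ := hB₁ x y z hxy
      · exact .inl (hEA s _ hs)
      · exact .inl (hEB s hs _ h)
    · by_cases hs : ∑ x ∈ u, x = s₀
      · exact .inr (hFT u (mem_sumTriples.2 ⟨hu, hs⟩))
      · obtain ⟨s, hs, h⟩ := hB₃ u hu hs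
        exact .inl (hEB s hs _ h)
    · obtain ⟨s, hs⟩ := hA₃ u hu
      exact .inl (hEA s _ hs)
  · intro t ht
    rcases triple_cases ht with ⟨x, y, z, hxy, rfl⟩ | ⟨x, y, z, hxy, rfl⟩ | ⟨_ | _, u, hu, rfl⟩
    · exact .inl (hF₁ x y z hxy)
    · refine .inr fun a => Joins.flipTarget ?_
      simpa [map_insert] using hF₁ x y z hxy a
    · refine .inr fun a => Joins.flipTarget ?_
      rw [map_flipCol_col]
      exact hF₃ u hu a
    · exact .inl (hF₃ u hu)
  · intro Q hQc x
    obtain ⟨t, ht, htc, h⟩ := hQ (Q.map flipCol.toEmbedding) (by rw [card_map, hQc]) x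
    refine ⟨t.map flipCol.toEmbedding, ?_, by rw [card_map, htc], Joins.flipTarget ?_⟩
    · rw [← map_flipCol_map_flipCol Q]
      exact map_subset_map.2 ht
    · rwa [map_flipCol_map_flipCol]
  · have h1 : (flipTarget F).card ≤ F.card := card_image_le
    have h2 : ∑ i, (Sum.elim A (fun s : {s // s ≠ s₀} => B s.1) i).card =
        ∑ s, (A s).card + ∑ s ∈ univ.erase s₀, (B s).card := by
      rw [Fintype.sum_sum_type]
      simp only [Sum.elim_inl, Sum.elim_inr]
      congr 1
      exact (sum_subtype (univ.erase s₀) (by simp) fun s => (B s).card).symm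
    rw [h2] at hEc
    rw [hV]
    omega

end Core

section Counting

variable {G : Type*} [DecidableEq G] [Fintype G] [AddCommGroup G]

/-- The solutions of `3a = s`. -/
def thirds (s : G) : Finset G := univ.filter fun a => a + a + a = s

theorem mem_thirds {s a : G} : a ∈ thirds s ↔ a + a + a = s := by simp [thirds]

theorem sum_card_thirds : ∑ s : G, (thirds s).card = Fintype.card G := by
  rw [← card_univ, card_eq_sum_card_fiberwise (f := fun a : G => a + a + a) (t := univ)
    (fun _ _ => by simp)]
  rfl

theorem six_mul_card_sumTriples_le (s : G) :
    6 * (sumTriples s).card + 3 * Fintype.card G ≤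
      Fintype.card G * Fintype.card G + 2 * (thirds s).card := by
  let N : Finset G := univ \ thirds s
  let P₁ : Finset (G × G) := univ.image fun a => (a, a)
  let P₂ : Finset (G × G) := N.image fun a => (a, s - a - a)
  let P₃ : Finset (G × G) := N.image fun a => (s - a - a, a)
  have hN : ∀ a, a ∈ N ↔ a + a + a ≠ s := by simp [N, mem_thirds]
  have hNc : N.card + (thirds s).card = Fintype.card G := by
    rw [card_sdiff_add_card_eq_card (subset_univ _), card_univ]
  have c₁ : P₁.card = Fintype.card G := by
    rw [card_image_of_injective _ fun a b h => congrArg Prod.fst h, card_univ]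
  have c₂ : P₂.card = N.card := card_image_of_injective _ fun a b h => congrArg Prod.fst h
  have c₃ : P₃.card = N.card := card_image_of_injective _ fun a b h => congrArg Prod.snd h
  have d₁ : Disjoint P₁ P₂ := by
    rw [disjoint_left]
    intro p h₁ h₂
    obtain ⟨a, -, rfl⟩ := mem_image.1 h₁
    obtain ⟨b, hb, h⟩ := mem_image.1 h₂
    simp only [Prod.mk.injEq] at h
    obtain ⟨rfl, h⟩ := h
    rw [hN] at hb
    exact hb (by rw [sub_sub, sub_eq_iff_eq_add] at h; rw [h]; abel)
  have d₂ : Disjoint (P₁ ∪ P₂) P₃ := by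
    rw [disjoint_left]
    intro p h₁ h₂
    obtain ⟨b, hb, rfl⟩ := mem_image.1 h₂
    rw [hN] at hb
    rcases mem_union.1 h₁ with h₁ | h₁ <;> obtain ⟨a, ha, h⟩ := mem_image.1 h₁ <;>
      simp only [Prod.mk.injEq] at h
    · obtain ⟨h, rfl⟩ := h
      exact hb (by rw [sub_sub, eq_sub_iff_add_eq] at h; rw [← h]; abel)
    · rw [hN] at ha
      obtain ⟨h, h'⟩ := h
      rw [h] at h'
      apply hb
      have h2 : b = s - a - a := by rw [← h', h]
      have h3 : a = b := by
        have h4 : a + b + b = s := by rw [h]; abel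
        have h5 : a + a + b = s := by rw [h2]; abel
        rw [← h5] at h4
        simpa [add_assoc] using h4.symm
      rw [← h3]
      have h5 : a + a + b = s := by rw [h2]; abel
      rwa [← h3] at h5
  have hdisj : Disjoint ((sumTriples s).biUnion offDiag) (P₁ ∪ P₂ ∪ P₃) := by
    rw [disjoint_left]
    intro p hp h
    obtain ⟨t, ht, hp⟩ := mem_biUnion.1 hp
    obtain ⟨x, y⟩ := p
    obtain ⟨hx, hy, hxy⟩ := mem_offDiag.1 hp
    simp only at hx hy hxy
    obtain ⟨htc, hts⟩ := mem_sumTriples.1 ht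
    obtain ⟨z, hz⟩ : ∃ z, (t.erase x).erase y = {z} := card_eq_one.1 (by
      rw [card_erase_of_mem (mem_erase.2 ⟨hxy.symm, hy⟩), card_erase_of_mem hx, htc])
    have hz' : z ∈ (t.erase x).erase y := by rw [hz]; simp
    obtain ⟨hzy, hzx⟩ : z ≠ y ∧ z ≠ x := by
      simp only [mem_erase] at hz'
      exact ⟨hz'.1, hz'.2.1⟩
    have hsum : x + (y + z) = s := by
      rw [← hts, ← add_sum_erase _ _ hx, ← add_sum_erase (t.erase x) _
        (mem_erase.2 ⟨hxy.symm, hy⟩), hz, sum_singleton]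
    simp only [mem_union] at h
    rcases h with (hm | hm) | hm <;> obtain ⟨a, ha, hp⟩ := mem_image.1 hm <;>
      obtain ⟨h₁, h₂⟩ := Prod.mk.inj hp
    · exact hxy (h₁.symm.trans h₂)
    · apply hzx
      have : z - x = x + (y + z) - s + (s - a - a - y) + (a - x) + (a - x) := by abel
      rwa [hsum, h₂, h₁, sub_self, sub_self, sub_self, zero_add, zero_add, zero_add,
        sub_eq_zero] at this
    · apply hzy
      have : z - y = x + (y + z) - s + (s - a - a - x) + (a - y) + (a - y) := by abel
      rwa [hsum, h₁, h₂, sub_self, sub_self, sub_self, zero_add, zero_add, zero_add,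
        sub_eq_zero] at this
  have hcard : ((sumTriples s).biUnion offDiag).card = 6 * (sumTriples s).card := by
    rw [card_biUnion, sum_congr rfl (g := fun _ => 6), sum_const, smul_eq_mul, mul_comm]
    · intro t ht
      rw [offDiag_card, (mem_sumTriples.1 ht).1]
    · intro t ht t' ht' hne
      rw [Function.onFun, disjoint_left]
      rintro ⟨x, y⟩ h h'
      obtain ⟨hx, hy, hxy⟩ := mem_offDiag.1 h
      obtain ⟨hx', hy', -⟩ := mem_offDiag.1 h'
      simp only at hx hy hxy hx' hy'
      have : ∀ u ∈ sumTriples s, x ∈ u → y ∈ u → u = {x, y, s - x - y} := by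
        intro u hu hx hy
        obtain ⟨huc, hus⟩ := mem_sumTriples.1 hu
        have hy2 : y ∈ u.erase x := mem_erase.2 ⟨hxy.symm, hy⟩
        obtain ⟨z, hz⟩ : ∃ z, (u.erase x).erase y = {z} := card_eq_one.1 (by
          rw [card_erase_of_mem hy2, card_erase_of_mem hx, huc])
        have hsum : x + (y + z) = s := by
          rw [← hus, ← add_sum_erase _ _ hx, ← add_sum_erase (u.erase x) _ hy2, hz, sum_singleton]
        rw [← insert_erase hx, ← insert_erase hy2, hz, ← hsum]
        congr 3
        abel
      exact hne ((this t ht hx hy).trans (this t' ht' hx' hy').symm)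
  have htot := card_le_univ ((sumTriples s).biUnion offDiag ∪ (P₁ ∪ P₂ ∪ P₃))
  rw [card_union_of_disjoint hdisj, card_union_of_disjoint d₂, card_union_of_disjoint d₁, hcard,
    c₁, c₂, c₃, Fintype.card_prod] at htot
  omega

/-- The triples with sum `s` miss only the pairs `{a, s - 2a}`. -/
theorem pairCover_sumTriples_union {s : G} {E : Finset (Finset G)} (hE : ∀ t ∈ E, t.card ≤ 3)
    (hc : ∀ a, s - a - a ≠ a → Covered E {a, s - a - a}) : PairCover (sumTriples s ∪ E) := by
  refine ⟨fun t ht => ?_, fun x y hxy => ?_⟩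
  · rcases mem_union.1 ht with ht | ht
    · exact (mem_sumTriples.1 ht).1.le
    · exact hE t ht
  · have hd : ∀ x y : G, x ≠ y → s - x - y = x → Covered (sumTriples s ∪ E) {x, y} := by
      intro x y hxy h
      have hy : y = s - x - x := by
        rw [sub_eq_iff_eq_add] at h
        rw [h]; abel
      rw [hy]
      exact (hc x (by rw [← hy]; exact hxy.symm)).mono subset_union_right subset_rfl
    by_cases h1 : s - x - y = x
    · exact hd x y hxy h1
    by_cases h2 : s - x - y = y
    · rw [pair_comm]
      exact hd y x hxy.symm (by rwa [sub_right_comm])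
    · refine ⟨{x, y, s - x - y}, mem_union_left _ (mem_sumTriples.2 ⟨?_, ?_⟩), ?_⟩
      · exact card_eq_three.2 ⟨x, y, _, hxy, Ne.symm h1, Ne.symm h2, rfl⟩
      · rw [sum_insert (by simp [hxy, Ne.symm h1]), sum_pair (Ne.symm h2)]
        abel
      · intro z hz
        simp only [mem_insert, mem_singleton] at hz ⊢
        tauto

end Counting

section Degenerate

theorem exists_maximal_independent {α : Type*} [Fintype α] [DecidableEq α] (σ : Equiv.Perm α)
    {Y₀ : Finset α} (h₀ : ∀ a ∈ Y₀, σ a ∉ Y₀) :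
    ∃ Y, Y₀ ⊆ Y ∧ (∀ a ∈ Y, σ a ∉ Y) ∧
      ∀ a, σ a ≠ a → a ∈ Y ∨ a ∈ Y.image σ ∨ a ∈ Y.image σ.symm := by
  obtain ⟨Y, hY, hmax⟩ := (univ.filter fun Y : Finset α => ∀ a ∈ Y, σ a ∉ Y).exists_le_maximal
    (a := Y₀) (by simpa using h₀)
  have hYi : ∀ a ∈ Y, σ a ∉ Y := by simpa using hmax.prop
  refine ⟨Y, hY, hYi, fun a ha => ?_⟩
  by_contra! hcon
  obtain ⟨h1, h2, h3⟩ := hcon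
  refine h1 (hmax.le_of_ge (y := insert a Y) ?_ (subset_insert _ _) (mem_insert_self _ _))
  simp only [mem_filter, mem_univ, true_and, mem_insert]
  rintro b (rfl | hb) (h | h)
  · exact ha h
  · exact h3 (mem_image.2 ⟨_, h, by simp⟩)
  · exact h2 (mem_image.2 ⟨_, hb, h⟩)
  · exact hYi b hb h

theorem exists_edge_cover_perm {α : Type*} [Fintype α] [DecidableEq α] (σ : Equiv.Perm α)
    {Y₀ : Finset α} (h₀ : ∀ a ∈ Y₀, σ a ∉ Y₀) :
    ∃ X : Finset α, (∀ a, σ a ≠ a → a ∈ X ∨ σ.symm a ∈ X) ∧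
      3 * X.card + (Y₀.image σ ∩ Y₀.image σ.symm).card ≤
        2 * (univ.filter fun a => σ a ≠ a).card := by
  obtain ⟨Y, hY, hYi, hmax⟩ := exists_maximal_independent σ h₀
  let X := (univ.filter fun a => σ a ≠ a) \ Y
  have hYN : Y ⊆ univ.filter fun a => σ a ≠ a := by
    intro a ha
    simp only [mem_filter, mem_univ, true_and]
    intro h
    exact hYi a ha (by rwa [h])
  have hX : X.card + Y.card = (univ.filter fun a => σ a ≠ a).card :=
    card_sdiff_add_card_eq_card hYN
  refine ⟨X, fun a ha => ?_, ?_⟩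
  · by_cases haY : a ∈ Y
    · right
      simp only [X, mem_sdiff, mem_filter, mem_univ, true_and, Equiv.apply_symm_apply]
      exact ⟨fun h => ha ((Equiv.eq_symm_apply σ).1 h), fun h => hYi _ h (by simpa using haY)⟩
    · left
      simpa [X, haY] using ha
  · have h1 : X ⊆ Y.image σ ∪ Y.image σ.symm := by
      intro a ha
      simp only [X, mem_sdiff, mem_filter, mem_univ, true_and] at ha
      rcases hmax a ha.1 with h | h | h
      · exact absurd h ha.2
      · exact mem_union_left _ h
      · exact mem_union_right _ h
    have h2 := card_le_card h1
    have h3 := card_union_add_card_inter (Y.image σ) (Y.image σ.symm)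
    have h4 : (Y₀.image σ ∩ Y₀.image σ.symm).card ≤ (Y.image σ ∩ Y.image σ.symm).card :=
      card_le_card (inter_subset_inter (image_subset_image hY) (image_subset_image hY))
    have h5 : (Y.image σ).card ≤ Y.card := card_image_le
    have h6 : (Y.image σ.symm).card ≤ Y.card := card_image_le
    omega

variable {w : ℕ} [NeZero w]

theorem card_thirds_add_card_filter_ne (s : ZMod w) :
    (univ.filter fun a : ZMod w => s - a - a ≠ a).card + (thirds s).card = w := by
  have h := card_filter_add_card_filter_not (s := (univ : Finset (ZMod w)))
    (fun a => s - a - a ≠ a)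
  rw [card_univ, ZMod.card] at h
  refine Eq.trans ?_ h
  congr 2
  ext a
  simp only [mem_thirds, mem_filter, mem_univ, true_and, not_not]
  constructor <;> intro h <;> linear_combination -h

theorem exists_cover_degenerate (hw : Odd w) (s : ZMod w) {Y₀ : Finset (ZMod w)}
    (h₀ : ∀ a ∈ Y₀, s - a - a ∉ Y₀) :
    ∃ E : Finset (Finset (ZMod w)), (∀ t ∈ E, t.card ≤ 3) ∧
      (∀ a, s - a - a ≠ a → Covered E {a, s - a - a}) ∧
      3 * E.card + 2 * (thirds s).card +
        (univ.filter fun a => ∃ b ∈ Y₀, ∃ c ∈ Y₀, a = s - b - b ∧ c = s - a - a).card ≤ 2 * w := by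
  have h2 : IsUnit (2 : ZMod w) := by
    have := (ZMod.isUnit_iff_coprime 2 w).2 (Nat.coprime_two_left.2 hw)
    exact_mod_cast this
  let σ : Equiv.Perm (ZMod w) := Equiv.ofBijective (fun a => s - a - a)
    (Finite.injective_iff_bijective.1 fun a b h => h2.mul_left_cancel (by
      have h' : s - a - a = s - b - b := h
      linear_combination -h'))
  have hσ : ∀ a, σ a = s - a - a := fun a => rfl
  obtain ⟨X, hX, hXc⟩ := exists_edge_cover_perm σ (Y₀ := Y₀) h₀
  refine ⟨X.image fun a => {a, σ a, σ (σ a)}, ?_, ?_, ?_⟩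
  · intro t ht
    obtain ⟨a, -, rfl⟩ := mem_image.1 ht
    exact card_le_three
  · intro a ha
    rcases hX a ha with h | h
    · refine ⟨_, mem_image_of_mem _ h, ?_⟩
      rw [← hσ]
      intro x hx
      simp only [mem_insert, mem_singleton] at hx ⊢
      tauto
    · refine ⟨_, mem_image_of_mem _ h, ?_⟩
      rw [← hσ, Equiv.apply_symm_apply]
      intro x hx
      simp only [mem_insert, mem_singleton] at hx ⊢
      tauto
  · have h1 : (X.image fun a => ({a, σ a, σ (σ a)} : Finset (ZMod w))).card ≤ X.card :=
      card_image_le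
    have h3 := card_thirds_add_card_filter_ne s
    have h4 : (univ.filter fun a => ∃ b ∈ Y₀, ∃ c ∈ Y₀, a = s - b - b ∧ c = s - a - a).card ≤
        (Y₀.image σ ∩ Y₀.image σ.symm).card := by
      refine card_le_card fun a ha => ?_
      simp only [mem_filter, mem_univ, true_and] at ha
      obtain ⟨b, hb, c, hc, hab, hca⟩ := ha
      refine mem_inter.2 ⟨mem_image.2 ⟨b, hb, hab.symm⟩, mem_image.2 ⟨c, hc, ?_⟩⟩
      rw [Equiv.symm_apply_eq, hca, hσ]
    change 3 * X.card + _ ≤ 2 * (univ.filter fun a => s - a - a ≠ a).card at hXc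
    omega

theorem three_dvd_card_thirds (hw : 3 ∣ w) (s : ZMod w) : 3 ∣ (thirds s).card := by
  obtain ⟨k, hk⟩ := hw
  have h3 : (k : ZMod w) + k + k = 0 := by
    have : ((3 * k : ℕ) : ZMod w) = 0 := by rw [← hk]; simp
    push_cast at this
    linear_combination this
  have hk0 : (k : ZMod w) ≠ 0 := by
    intro h
    rw [ZMod.natCast_eq_zero_iff] at h
    have hw0 := NeZero.ne w
    have := Nat.le_of_dvd (by omega) h
    omega
  let f : Function.End {a : ZMod w // a ∈ thirds s} := fun a => ⟨a.1 + k, by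
    have := mem_thirds.1 a.2
    rw [mem_thirds]
    linear_combination this + h3⟩
  have hf : f ^ 3 ^ 1 = 1 := by
    funext a
    apply Subtype.ext
    change a.1 + k + k + k = a.1
    linear_combination h3
  have : Fact (Nat.Prime 3) := ⟨Nat.prime_three⟩
  have hfix := Equiv.Perm.card_fixedPoints_modEq hf
  rw [Fintype.card_coe] at hfix
  have h0 : Fintype.card f.fixedPoints = 0 := by
    rw [Fintype.card_eq_zero_iff]
    refine ⟨fun a => hk0 ?_⟩
    have := congrArg Subtype.val (show f a.1 = a.1 from a.2)
    simpa [f] using this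
  rw [h0] at hfix
  exact (Nat.modEq_zero_iff_dvd).1 hfix

theorem card_thirds_of_coprime (hw : Nat.Coprime 3 w) (s : ZMod w) : (thirds s).card = 1 := by
  have h3 : IsUnit (3 : ZMod w) := by
    have := (ZMod.isUnit_iff_coprime 3 w).2 hw
    exact_mod_cast this
  obtain ⟨u, hu⟩ := h3.exists_right_inv
  rw [card_eq_one]
  refine ⟨u * s, ?_⟩
  ext a
  rw [mem_thirds, mem_singleton]
  constructor
  · intro h
    linear_combination u * h - a * hu
  · rintro rfl
    linear_combination s * hu

theorem card_thirds_one (hw : 3 ∣ w) : (thirds (1 : ZMod w)).card = 0 := by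
  rw [card_eq_zero, eq_empty_iff_forall_notMem]
  intro a ha
  rw [mem_thirds] at ha
  have h := congrArg (ZMod.castHom hw (ZMod 3)) ha
  simp only [map_add, map_one] at h
  generalize ZMod.castHom hw (ZMod 3) a = b at h
  revert b
  decide

set_option maxRecDepth 10000 in
theorem exists_cover_degenerate_nine (s : ZMod 9) (hs : s + s + s = 0) :
    ∃ E : Finset (Finset (ZMod 9)), (∀ t ∈ E, t.card ≤ 3) ∧
      (∀ a, s - a - a ≠ a → Covered E {a, s - a - a}) ∧
      3 * E.card + 2 * (thirds s).card + 3 ≤ 2 * 9 := by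
  have h : s = 0 ∨ s = 3 ∨ s = 6 := by revert s; decide
  unfold Covered
  rcases h with rfl | rfl | rfl
  · exact ⟨{{1, 7, 4}, {2, 5, 8}}, by decide, by decide, by decide⟩
  · exact ⟨{{2, 8, 5}, {3, 6, 0}}, by decide, by decide, by decide⟩
  · exact ⟨{{3, 0, 6}, {4, 7, 1}}, by decide, by decide, by decide⟩

theorem exists_cover_degenerate_of_three_dvd (hw : Odd w) (h3 : 3 ∣ w) (h5 : 5 ≤ w)
    (s : ZMod w) :
    ∃ E : Finset (Finset (ZMod w)), (∀ t ∈ E, t.card ≤ 3) ∧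
      (∀ a, s - a - a ≠ a → Covered E {a, s - a - a}) ∧
      3 * E.card + 2 * (thirds s).card + 3 ≤ 2 * w := by
  by_cases hex : ∃ a : ZMod w, 9 * a ≠ 3 * s
  · obtain ⟨a, ha⟩ := hex
    have h1 : s - a - a ≠ a := fun h => ha (by linear_combination -3 * h)
    obtain ⟨E, hE, hc, hcard⟩ := exists_cover_degenerate hw s
      (Y₀ := {a, s - (s - a - a) - (s - a - a)}) (by
        have h2 : IsUnit (2 : ZMod w) := by
          have := (ZMod.isUnit_iff_coprime 2 w).2 (Nat.coprime_two_left.2 hw)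
          exact_mod_cast this
        intro b hb
        simp only [mem_insert, mem_singleton] at hb ⊢
        rintro (h | h) <;> rcases hb with rfl | rfl
        · exact h1 h
        · exact ha (by linear_combination -h)
        · exact ha (h2.mul_left_cancel (by linear_combination -3 * h))
        · exact ha (h2.mul_left_cancel (h2.mul_left_cancel (by linear_combination -3 * h))))
    refine ⟨E, hE, hc, ?_⟩
    have hpos : 1 ≤ (univ.filter fun x => ∃ b ∈ ({a, s - (s - a - a) - (s - a - a)} :
        Finset (ZMod w)), ∃ c ∈ ({a, s - (s - a - a) - (s - a - a)} : Finset (ZMod w)),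
        x = s - b - b ∧ c = s - x - x).card := by
      refine card_pos.2 ⟨s - a - a, ?_⟩
      simp only [mem_filter, mem_univ, true_and]
      exact ⟨a, by simp, _, mem_insert_of_mem (mem_singleton_self _), rfl, rfl⟩
    obtain ⟨k, hk⟩ := three_dvd_card_thirds h3 s
    obtain ⟨m, rfl⟩ := h3
    omega
  · push Not at hex
    have h0 : (3 : ZMod w) * s = 0 := by simpa using (hex 0).symm
    have h9 : ((9 : ℕ) : ZMod w) = 0 := by
      have := hex 1
      rw [h0] at this
      push_cast
      simpa using this
    rw [ZMod.natCast_eq_zero_iff] at h9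
    have hw9 : w = 9 := by
      have := Nat.le_of_dvd (by norm_num) h9
      interval_cases w <;> omega
    subst hw9
    exact exists_cover_degenerate_nine s (by linear_combination h0)

theorem exists_cover_degenerate_even (hw : Even w) (s : ZMod w) :
    ∃ E : Finset (Finset (ZMod w)), (∀ t ∈ E, t.card ≤ 3) ∧
      (∀ a, s - a - a ≠ a → Covered E {a, s - a - a}) ∧ 2 * E.card ≤ w := by
  obtain ⟨k, hk⟩ := hw
  have h2 : (k : ZMod w) + k = 0 := by
    have : ((k + k : ℕ) : ZMod w) = 0 := by rw [← hk]; simp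
    exact_mod_cast this
  have hk0 : (k : ZMod w) ≠ 0 := by
    intro h
    rw [ZMod.natCast_eq_zero_iff] at h
    have hw0 := NeZero.ne w
    have := Nat.le_of_dvd (by omega) h
    omega
  refine ⟨univ.image fun a : ZMod w => ({a, a + k, s - a - a} : Finset (ZMod w)), ?_, ?_, ?_⟩
  · intro t ht
    obtain ⟨a, -, rfl⟩ := mem_image.1 ht
    exact card_le_three
  · intro a _
    refine ⟨_, mem_image_of_mem _ (mem_univ a), fun x hx => ?_⟩
    simp only [mem_insert, mem_singleton] at hx ⊢
    tauto
  · refine (two_mul_card_image_le (fun a => a + (k : ZMod w)) (fun _ _ => mem_univ _)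
      (fun a _ h => hk0 (by simpa using h)) fun a _ => ?_).trans_eq (by simp)
    rw [show a + (k : ZMod w) + k = a by linear_combination h2,
      show s - (a + k) - (a + k) = s - a - a by linear_combination -h2, insert_comm]

end Degenerate

section Layer

variable {G : Type*} [DecidableEq G] [Fintype G]

/-- The triples made of a pair matched by `m z` in column `i` and the point `z` of the other
column. -/
def layer (i : Bool) (m : G → G → G) : Finset (Finset (G × Bool)) :=
  (univ.filter fun p : G × G => m p.2 p.1 ≠ p.1).image
    fun p => {(p.1, i), (m p.2 p.1, i), (p.2, !i)}

variable {i : Bool} {m : G → G → G}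

theorem covered_layer {x z : G} (h : m z x ≠ x) :
    Covered (layer i m) {(x, i), (m z x, i), (z, !i)} :=
  ⟨_, mem_image.2 ⟨(x, z), by simpa using h, rfl⟩, subset_rfl⟩

theorem two_mul_card_layer_le_card_filter (hm : ∀ z x, m z (m z x) = x) :
    2 * (layer i m).card ≤ (univ.filter fun p : G × G => m p.2 p.1 ≠ p.1).card := by
  refine two_mul_card_image_le (fun p : G × G => (m p.2 p.1, p.2)) (fun p hp => ?_)
    (fun p hp h => ?_) fun p _ => ?_
  · simp only [mem_filter, mem_univ, true_and, hm] at hp ⊢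
    exact hp.symm
  · exact (mem_filter.1 hp).2 (congrArg Prod.fst h)
  · simp only [hm]
    rw [insert_comm]

theorem two_mul_card_layer_le (hm : ∀ z x, m z (m z x) = x) :
    2 * (layer i m).card ≤ Fintype.card G * Fintype.card G :=
  (two_mul_card_layer_le_card_filter hm).trans
    ((card_le_univ _).trans_eq (Fintype.card_prod _ _))

theorem two_mul_card_layer_add_le (hm : ∀ z x, m z (m z x) = x) (f : G → G)
    (hf : ∀ x, m (f x) x = x) :
    2 * (layer i m).card + Fintype.card G ≤ Fintype.card G * Fintype.card G := by
  have h1 := two_mul_card_layer_le_card_filter (i := i) hm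
  have h2 : Disjoint (univ.filter fun p : G × G => m p.2 p.1 ≠ p.1)
      (univ.image fun x => (x, f x)) := by
    rw [disjoint_left]
    intro p hp h
    obtain ⟨x, -, rfl⟩ := mem_image.1 h
    exact (mem_filter.1 hp).2 (hf x)
  have h3 := card_le_univ ((univ.filter fun p : G × G => m p.2 p.1 ≠ p.1) ∪
    univ.image fun x => (x, f x))
  rw [card_union_of_disjoint h2, card_image_of_injective _ fun a b h => congrArg Prod.fst h,
    card_univ, Fintype.card_prod] at h3
  omega

/-- A family of triples on `G × Bool` assembled from a layer, triples inside the other column,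
and further triples `X`. -/
def layerCover (i : Bool) (m : G → G → G) (L : Finset (Finset G)) (X : Finset (Finset (G × Bool))) :
    Finset (Finset (G × Bool)) :=
  layer i m ∪ L.image (col (!i)) ∪ X

variable {L : Finset (Finset G)} {X : Finset (Finset (G × Bool))}

theorem card_layerCover_le : (layerCover i m L X).card ≤ (layer i m).card + L.card + X.card :=
  (card_union_le _ _).trans (Nat.add_le_add_right
    ((card_union_le _ _).trans (Nat.add_le_add_left card_image_le _)) _)

theorem Covered.layerCover {u : Finset G} (h : Covered L u) :
    Covered (layerCover i m L X) (_root_.col (!i) u) :=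
  (h.col _).mono (subset_union_right.trans subset_union_left) subset_rfl

theorem covered_layerCover {x z : G} (h : m z x ≠ x) :
    Covered (layerCover i m L X) {(x, i), (m z x, i), (z, !i)} :=
  (covered_layer h).mono (subset_union_left.trans subset_union_left) subset_rfl

theorem covered_layerCover_of_right {t : Finset (G × Bool)} (h : Covered X t) :
    Covered (layerCover i m L X) t :=
  h.mono subset_union_right subset_rfl

theorem pairCover_layerCover (hL : ∀ t ∈ L, t.card ≤ 3) (hX : ∀ t ∈ X, t.card ≤ 3)
    (hp : ∀ x y, x ≠ y → Covered L {x, y} ∨ Covered X {(x, !i), (y, !i)})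
    (hm : ∀ x y, x ≠ y → ∃ z, m z x = y)
    (hc : ∀ x z, m z x = x → Covered X {(x, i), (z, !i)}) : PairCover (layerCover i m L X) := by
  refine ⟨fun t ht => ?_, ?_⟩
  · rcases mem_union.1 ht with ht | ht
    · rcases mem_union.1 ht with ht | ht <;> obtain ⟨p, hp, rfl⟩ := mem_image.1 ht
      · exact card_le_three
      · rw [card_col]; exact hL _ hp
    · exact hX t ht
  have hcross : ∀ x z, Covered (layerCover i m L X) {(x, i), (z, !i)} := by
    intro x z
    by_cases h : m z x = x
    · exact covered_layerCover_of_right (hc x z h)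
    · refine (covered_layerCover h).mono subset_rfl fun a ha => ?_
      simp only [mem_insert, mem_singleton] at ha ⊢
      tauto
  rintro ⟨x, j⟩ ⟨y, k⟩ hxy
  by_cases hj : j = i <;> by_cases hk : k = i
  · subst hj hk
    have hne : x ≠ y := fun h => hxy (by rw [h])
    obtain ⟨z, rfl⟩ := hm x y hne
    refine (covered_layerCover hne.symm).mono subset_rfl fun a ha => ?_
    simp only [mem_insert, mem_singleton] at ha ⊢
    tauto
  · obtain rfl : k = !i := by cases k <;> cases i <;> simp_all
    rw [hj]
    exact hcross x y
  · obtain rfl : j = !i := by cases j <;> cases i <;> simp_all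
    rw [hk, pair_comm]
    exact hcross y x
  · obtain rfl : k = !i := by cases k <;> cases i <;> simp_all
    obtain rfl : j = !i := by cases j <;> cases i <;> simp_all
    have hne : x ≠ y := fun h => hxy (by rw [h])
    rcases hp x y hne with h | h
    · simpa using h.layerCover (i := i) (m := m) (X := X)
    · exact covered_layerCover_of_right h

end Layer

section Sums

variable {G : Type*} [DecidableEq G] [Fintype G] [AddCommGroup G]

theorem sum_offDiag_add_sum_diag (f : G → ℕ) :
    ∑ p ∈ (univ : Finset G).offDiag, f (p.1 + p.2) + ∑ x, f (x + x) =
      Fintype.card G * ∑ s, f s := by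
  have h1 : ∑ x : G, f (x + x) = ∑ p ∈ (univ : Finset G).diag, f (p.1 + p.2) := by
    rw [sum_diag]
  rw [h1, add_comm, ← sum_union (disjoint_diag_offDiag _), diag_union_offDiag, sum_product]
  simp only [fun x : G => show ∑ y, f (x + y) = ∑ y, f y from Equiv.sum_comp (Equiv.addLeft x) f,
    sum_const, card_univ, smul_eq_mul]

theorem sum_card_thirds_erase (s₀ : G) :
    ∑ s ∈ univ.erase s₀, (thirds s).card + (thirds s₀).card = Fintype.card G := by
  rw [sum_erase_add _ _ (mem_univ _), sum_card_thirds]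

theorem two_mul_sum_card_wedge_le (K : G → Finset (Finset G)) :
    2 * ∑ p ∈ (univ : Finset G).offDiag, (wedge K (p.1 + p.2)).card ≤
      (Fintype.card G * Fintype.card G - Fintype.card G) ^ 2 +
        2 * ∑ p ∈ (univ : Finset G).offDiag, (K (p.1 + p.2)).card := by
  rw [mul_sum, mul_sum]
  refine (sum_le_sum fun p _ => two_mul_card_wedge_le K (p.1 + p.2)).trans_eq ?_
  rw [sum_add_distrib, sum_const, offDiag_card, card_univ, smul_eq_mul, sq]

end Sums

section Odd

variable {w : ℕ} [NeZero w]

theorem exists_pairCovers_odd (hw : Odd w) : ∃ A B : ZMod w → Finset (Finset (ZMod w × Bool)),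
    (∀ s, PairCover (A s)) ∧ (∀ s, PairCover (B s)) ∧
    (∀ x y z, x ≠ y → ∃ s, Covered (A s) {(x, false), (y, false), (z, true)}) ∧
    (∀ t : Finset (ZMod w), t.card = 3 → ∃ s, Covered (A s) (col true t)) ∧
    (∀ x y z, x ≠ y → (∃ s, Covered (A s) {(x, true), (y, true), (z, false)}) ∨
      ∃ s, s ≠ 1 ∧ Covered (B s) {(x, true), (y, true), (z, false)}) ∧
    (∀ t : Finset (ZMod w), t.card = 3 → ∑ x ∈ t, x ≠ 1 →
      ∃ s, s ≠ 1 ∧ Covered (B s) (col false t)) ∧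
    (∀ s, 2 * (A s).card ≤ w * w + w + 2 * (sumTriples s).card) ∧
    ∀ s, 2 * (B s).card ≤ w * w + w + 2 * (sumTriples s).card := by
  have h2 : IsUnit (2 : ZMod w) := by
    have := (ZMod.isUnit_iff_coprime 2 w).2 (Nat.coprime_two_left.2 hw)
    exact_mod_cast this
  obtain ⟨u, hu⟩ := h2.exists_right_inv
  let X : ZMod w → Finset (Finset (ZMod w × Bool)) := fun c =>
    univ.image fun a => {(a - c, false), (a, true), (c - a - a, true)}
  let Y : ZMod w → Finset (Finset (ZMod w × Bool)) := fun s =>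
    univ.image fun x => {(x, true), (s - 1 - x - x, false),
      (s - (s - 1 - x - x) - (s - 1 - x - x), false)}
  let f : ZMod w → ZMod w → ZMod w → ZMod w := fun c z x => z + z - c - c - x
  let g : ZMod w → ZMod w → ZMod w → ZMod w := fun s z x => s - 1 - z - x
  have hf : ∀ c z x, f c z (f c z x) = x := fun c z x => by simp only [f]; ring
  have hg : ∀ c z x, g c z (g c z x) = x := fun c z x => by simp only [g]; ring
  have hX : ∀ c a, Covered (X c) {(a - c, false), (a, true), (c - a - a, true)} := fun c a =>
    ⟨_, mem_image_of_mem _ (mem_univ a), subset_rfl⟩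
  have hY : ∀ s x, Covered (Y s) {(x, true), (s - 1 - x - x, false),
      (s - (s - 1 - x - x) - (s - 1 - x - x), false)} := fun s x =>
    ⟨_, mem_image_of_mem _ (mem_univ x), subset_rfl⟩
  have hT : ∀ {s : ZMod w}, ∀ t ∈ sumTriples s, t.card ≤ 3 := fun t ht =>
    (mem_sumTriples.1 ht).1.le
  have hS : ∀ s x y : ZMod w, x ≠ y →
      Covered (sumTriples s) {x, y} ∨ y = s - x - x ∨ x = s - y - y := by
    intro s x y hxy
    by_cases h1 : s - x - y = x
    · right; left; linear_combination -h1
    by_cases h2 : s - x - y = y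
    · right; right; linear_combination -h2
    left
    refine ⟨{x, y, s - x - y}, mem_sumTriples.2 ⟨?_, ?_⟩, ?_⟩
    · exact card_eq_three.2 ⟨x, y, _, hxy, Ne.symm h1, Ne.symm h2, rfl⟩
    · rw [sum_insert (by simp [hxy, Ne.symm h1]), sum_pair (Ne.symm h2)]
      ring
    · intro z hz
      simp only [mem_insert, mem_singleton] at hz ⊢
      tauto
  have hcX : ∀ c, (X c).card ≤ w := fun c => card_image_le.trans_eq (by simp)
  have hcY : ∀ c, (Y c).card ≤ w := fun c => card_image_le.trans_eq (by simp)
  refine ⟨fun c => layerCover false (f c) (sumTriples c) (X c),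
    fun s => layerCover true (g s) (sumTriples s) (Y s), ?_, ?_, ?_, ?_, ?_, ?_, ?_, ?_⟩
  · intro c
    refine pairCover_layerCover hT (fun t ht => ?_) (fun x y hxy => ?_) (fun x y hxy => ?_)
      fun x z h => ?_
    · obtain ⟨a, -, rfl⟩ := mem_image.1 ht
      exact card_le_three
    · refine (hS c x y hxy).imp_right fun h => ?_
      rcases h with rfl | rfl
      · exact (hX c x).mono subset_rfl fun a ha => by
          simp only [Bool.not_false, mem_insert, mem_singleton] at ha ⊢; tauto
      · exact (hX c y).mono subset_rfl fun a ha => by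
          simp only [Bool.not_false, mem_insert, mem_singleton] at ha ⊢; tauto
    · exact ⟨c + u * (x + y), by simp only [f]; linear_combination (x + y) * hu⟩
    · obtain rfl : x = z - c := h2.mul_left_cancel (by simp only [f] at h; linear_combination -h)
      exact (hX c z).mono subset_rfl fun a ha => by
        simp only [Bool.not_false, mem_insert, mem_singleton] at ha ⊢; tauto
  · intro s
    have hY' : ∀ a, Covered (Y s) {(a, false), (s - a - a, false)} := by
      intro a
      have := hY s (u * (s - 1 - a))
      have ha : s - 1 - u * (s - 1 - a) - u * (s - 1 - a) = a := by
        linear_combination -(s - 1 - a) * hu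
      rw [ha] at this
      exact this.mono subset_rfl (subset_insert _ _)
    refine pairCover_layerCover hT (fun t ht => ?_) (fun x y hxy => ?_) (fun x y hxy => ?_)
      fun x z h => ?_
    · obtain ⟨a, -, rfl⟩ := mem_image.1 ht
      exact card_le_three
    · refine (hS s x y hxy).imp_right fun h => ?_
      rcases h with rfl | rfl
      · exact hY' x
      · rw [pair_comm]
        exact hY' y
    · exact ⟨s - 1 - x - y, by simp only [g]; ring⟩
    · obtain rfl : z = s - 1 - x - x := by simp only [g] at h; linear_combination -h
      exact (hY s x).mono subset_rfl fun a ha => by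
        simp only [Bool.not_true, mem_insert, mem_singleton] at ha ⊢; tauto
  · intro x y z hxy
    refine ⟨z - u * (x + y), ?_⟩
    have : f (z - u * (x + y)) z x = y := by simp only [f]; linear_combination (x + y) * hu
    have h := covered_layerCover (i := false) (L := sumTriples (z - u * (x + y)))
      (X := X (z - u * (x + y))) (this.trans_ne hxy.symm)
    rwa [this] at h
  · intro t ht
    exact ⟨∑ x ∈ t, x, Covered.layerCover (i := false)
      ⟨t, mem_sumTriples.2 ⟨ht, rfl⟩, subset_rfl⟩⟩
  · intro x y z hxy
    by_cases hd : x + y + z = 0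
    · left
      refine ⟨x + x + y, covered_layerCover_of_right ((hX (x + x + y) x).mono subset_rfl ?_)⟩
      rw [show x - (x + x + y) = z by linear_combination -hd,
        show x + x + y - x - x = y by ring]
      intro a ha
      simp only [mem_insert, mem_singleton] at ha ⊢
      tauto
    · right
      refine ⟨x + y + z + 1, by simpa using hd, ?_⟩
      have : g (x + y + z + 1) z x = y := by simp only [g]; ring
      have h := covered_layerCover (i := true) (L := sumTriples (x + y + z + 1))
        (X := Y (x + y + z + 1)) (this.trans_ne hxy.symm)
      rwa [this] at h
  · intro t ht hs
    exact ⟨∑ x ∈ t, x, hs, Covered.layerCover (i := true)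
      ⟨t, mem_sumTriples.2 ⟨ht, rfl⟩, subset_rfl⟩⟩
  · intro c
    have h1 := two_mul_card_layer_add_le (i := false) (hf c) (fun x => x + c)
      fun x => by simp only [f]; ring
    have h3 := card_layerCover_le (i := false) (m := f c) (L := sumTriples c) (X := X c)
    have h4 := hcX c
    rw [ZMod.card] at h1
    change 2 * (layerCover false (f c) (sumTriples c) (X c)).card ≤ _
    omega
  · intro s
    have h1 := two_mul_card_layer_add_le (i := true) (hg s) (fun x => s - 1 - x - x)
      fun x => by simp only [g]; ring
    have h3 := card_layerCover_le (i := true) (m := g s) (L := sumTriples s) (X := Y s)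
    have h4 := hcY s
    rw [ZMod.card] at h1
    change 2 * (layerCover true (g s) (sumTriples s) (Y s)).card ≤ _
    omega

end Odd

section Even

variable {G : Type*} [DecidableEq G] [Fintype G]

theorem exists_pairCovers_even (hG : Even (Fintype.card G)) (s₀ : G) {K : G → Finset (Finset G)}
    (hK : ∀ s, PairCover (K s)) : ∃ A B : G → Finset (Finset (G × Bool)),
    (∀ s, PairCover (A s)) ∧ (∀ s, PairCover (B s)) ∧
    (∀ x y z, x ≠ y → ∃ s, Covered (A s) {(x, false), (y, false), (z, true)}) ∧
    (∀ x y z, x ≠ y → ∃ s, s ≠ s₀ ∧ Covered (B s) {(x, true), (y, true), (z, false)}) ∧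
    (∀ s t, Covered (K s) t → Covered (A s) (col true t)) ∧
    (∀ s t, Covered (K s) t → Covered (B s) (col false t)) ∧
    (∀ s, 2 * (A s).card ≤ Fintype.card G * Fintype.card G + 2 * (K s).card) ∧
    ∀ s, 2 * (B s).card ≤ Fintype.card G * Fintype.card G + 2 * (K s).card := by
  have hpos : 0 < Fintype.card G := Fintype.card_pos_iff.2 ⟨s₀⟩
  obtain ⟨k, hk⟩ := hG
  let n := Fintype.card G - 1
  have hn : Odd n := ⟨k - 1, by omega⟩
  have : NeZero n := ⟨hn.pos.ne'⟩
  obtain ⟨μ⟩ := exists_matchingCover (C := ZMod n) (α := G) (by rwa [ZMod.card])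
    (by rw [ZMod.card]; omega)
  let e : {s : G // s ≠ s₀} ≃ ZMod n := Fintype.equivOfCardEq (by
    rw [ZMod.card, Fintype.card_subtype_compl, Fintype.card_subtype_eq])
  let c : G → ZMod n := fun s => if h : s ≠ s₀ then e ⟨s, h⟩ else 0
  have hc : ∀ r, ∃ s, s ≠ s₀ ∧ c s = r := fun r =>
    ⟨(e.symm r).1, (e.symm r).2, by
      simp only [c, dif_pos (e.symm r).2, Subtype.coe_eta, Equiv.apply_symm_apply]⟩
  let m : G → G → G → G := fun s z => μ.mate (c s + c z)
  have hm : ∀ s z x, m s z (m s z x) = x := fun s z x => μ.mate_mate _ x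
  have hne : ∀ s z x, m s z x ≠ x := fun s z x => μ.mate_ne _ x
  have hcov : ∀ i s, PairCover (layerCover i (m s) (K s) ∅) := by
    intro i s
    refine pairCover_layerCover (hK s).card_le (by simp) (fun x y hxy => .inl ((hK s).covers x y hxy))
      (fun x y hxy => ?_) fun x z h => absurd h (hne s z x)
    obtain ⟨r, hr⟩ := μ.exists_mate x y hxy
    obtain ⟨z, -, hz⟩ := hc (r - c s)
    exact ⟨z, by simp only [m, hz, add_sub_cancel, hr]⟩
  have hmix : ∀ i x y z, x ≠ y → ∃ s, s ≠ s₀ ∧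
      Covered (layerCover i (m s) (K s) ∅) {(x, i), (y, i), (z, !i)} := by
    intro i x y z hxy
    obtain ⟨r, hr⟩ := μ.exists_mate x y hxy
    obtain ⟨s, hs, hsr⟩ := hc (r - c z)
    have h := covered_layerCover (i := i) (L := K s) (X := ∅) (hne s z x)
    rw [show m s z x = y by simp only [m, hsr, sub_add_cancel, hr]] at h
    exact ⟨s, hs, h⟩
  have hcard : ∀ i s, 2 * (layerCover i (m s) (K s) ∅).card ≤
      Fintype.card G * Fintype.card G + 2 * (K s).card := by
    intro i s
    have h1 := two_mul_card_layer_le (i := i) (hm s)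
    have h2 := card_layerCover_le (i := i) (m := m s) (L := K s) (X := ∅)
    rw [card_empty] at h2
    omega
  refine ⟨fun s => layerCover false (m s) (K s) ∅, fun s => layerCover true (m s) (K s) ∅,
    hcov _, hcov _, fun x y z hxy => ?_, hmix true, fun s t h => h.layerCover (i := false),
    fun s t h => h.layerCover (i := true), hcard _, hcard _⟩
  obtain ⟨s, -, h⟩ := hmix false x y z hxy
  exact ⟨s, h⟩

/-- If the families `K s` with `s ≠ s₀` cover all triples of `G`, then so do the families of
triples constructed from them on `G × Bool`. -/
theorem coverNumber_le_of_covers_triples (h3 : 3 ≤ Fintype.card G) (hG : Even (Fintype.card G))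
    (s₀ : G) {K : G → Finset (Finset G)} (hK : ∀ s, PairCover (K s))
    (hKt : ∀ t : Finset G, t.card = 3 → ∃ s, s ≠ s₀ ∧ Covered (K s) t) {l : ℕ}
    (hl : ∀ s, Fintype.card G * Fintype.card G + 2 * (K s).card ≤ 2 * l) :
    coverNumber (4 * (2 * Fintype.card G)) 5 4 6 ≤
      2 * (coverNumber (2 * Fintype.card G) 5 4 5 + coverNumber (2 * Fintype.card G) 5 4 4) +
        6 * (Fintype.card G * ((2 * Fintype.card G - 1) * l)) := by
  obtain ⟨A, B, hA, hB, hA₁, hB₁, hA₃, hB₃, hAc, hBc⟩ := exists_pairCovers_even hG s₀ hK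
  have hV : Fintype.card (G × Bool) = 2 * Fintype.card G := by simp [mul_comm]
  have hI : Fintype.card (G ⊕ {s // s ≠ s₀}) = 2 * Fintype.card G - 1 := by
    rw [Fintype.card_sum, Fintype.card_subtype_compl, Fintype.card_subtype_eq]
    omega
  obtain ⟨E, hE, hEU, hEc⟩ := exists_joinsPairs (I := G ⊕ {s // s ≠ s₀}) (V := G × Bool)
    (w := Fintype.card G) (by rw [hI]; exact ⟨Fintype.card G - 1, by omega⟩) (by omega) hV
    (U := Sum.elim A fun s => B s.1) (by rintro (s | s); exacts [hA s, hB s.1])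
  have hU : ∀ i, (Sum.elim A (fun s : {s // s ≠ s₀} => B s.1) i).card ≤ l := by
    rintro (s | s)
    · have h1 := hAc s
      have h2 := hl s
      simp only [Sum.elim_inl]
      omega
    · have h1 := hBc s.1
      have h2 := hl s.1
      simp only [Sum.elim_inr]
      omega
  have hfull : ∀ t : Finset (G × Bool), t.card = 3 → ∀ x, Joins E {x} t := by
    intro t ht x
    rcases triple_cases ht with ⟨a, b, c, hab, rfl⟩ | ⟨a, b, c, hab, rfl⟩ | ⟨i, u, hu, rfl⟩
    · obtain ⟨s, hs⟩ := hA₁ a b c hab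
      exact hEU (.inl s) _ hs x
    · obtain ⟨s, hs, h⟩ := hB₁ a b c hab
      exact hEU (.inr ⟨s, hs⟩) _ h x
    · obtain ⟨s, hs, h⟩ := hKt u hu
      cases i
      · exact hEU (.inr ⟨s, hs⟩) _ (hB₃ s u h) x
      · exact hEU (.inl s) _ (hA₃ s u h) x
  have hQ : ∀ Q : Finset (G × Bool), Q.card = 4 → ∀ x, ∃ t ⊆ Q, t.card = 3 ∧ Joins E {x} t := by
    intro Q hQ x
    obtain ⟨t, ht, htc⟩ := exists_subset_card_eq (show 3 ≤ Q.card by omega)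
    exact ⟨t, ht, htc, hfull t htc x⟩
  have hmain := coverNumber_le_of_joins (V := G × Bool) (by omega) hE hE hE
    (fun t ht => .inl (hfull t ht)) (fun t ht => .inl (hfull t ht)) hQ hQ
  rw [hV] at hmain
  have hsum := sum_le_card_nsmul univ _ l fun i _ => hU i
  rw [card_univ, hI, smul_eq_mul] at hsum
  have := hEc.trans (Nat.mul_le_mul_left _ hsum)
  omega

theorem coverNumber_sixteen_le :
    coverNumber (4 * (2 * 4)) 5 4 6 ≤ 2 * (coverNumber (2 * 4) 5 4 5 + coverNumber (2 * 4) 5 4 4) +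
      6 * (4 * (7 * 11)) := by
  let K : ZMod 4 → Finset (Finset (ZMod 4)) := fun s => (powersetCard 3 univ).erase (univ.erase s)
  have hK : ∀ s, PairCover (K s) := fun s => ⟨by revert s; decide, by
    unfold Covered; revert s; decide⟩
  have := coverNumber_le_of_covers_triples (G := ZMod 4) (by simp) (by simp; decide) 0 hK
    (by unfold Covered; decide) (l := 11) (by simp only [ZMod.card]; decide)
  simpa only [ZMod.card] using this

/-- Six triples of `ZMod 6` for every `s`, covering all pairs. -/
def sixTriples (s : ZMod 6) : Finset (Finset (ZMod 6)) :=
  if s = 1 then {{0, 1, 3}, {0, 2, 4}, {0, 3, 5}, {1, 2, 5}, {1, 4, 5}, {2, 3, 4}}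
  else if s = 2 then {{0, 1, 2}, {0, 3, 4}, {0, 3, 5}, {1, 2, 3}, {1, 4, 5}, {2, 4, 5}}
  else if s = 3 then {{0, 1, 3}, {0, 1, 5}, {0, 2, 4}, {1, 2, 4}, {2, 3, 5}, {3, 4, 5}}
  else if s = 4 then {{0, 1, 2}, {0, 3, 5}, {0, 4, 5}, {1, 2, 5}, {1, 3, 4}, {2, 3, 4}}
  else {{0, 1, 4}, {0, 2, 3}, {0, 2, 5}, {1, 2, 4}, {1, 3, 5}, {3, 4, 5}}

set_option maxRecDepth 100000 in
set_option maxHeartbeats 1000000 in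
theorem pairCover_sixTriples (s : ZMod 6) : PairCover (sixTriples s) :=
  ⟨by revert s; decide, by unfold Covered; revert s; decide⟩

set_option maxRecDepth 100000 in
set_option maxHeartbeats 1000000 in
theorem coverNumber_twentyfour_le :
    coverNumber (4 * (2 * 6)) 5 4 6 ≤ 2 * (coverNumber (2 * 6) 5 4 5 + coverNumber (2 * 6) 5 4 4) +
      6 * (6 * (11 * 24)) := by
  have := coverNumber_le_of_covers_triples (G := ZMod 6) (by simp) (by simp; decide) 0
    pairCover_sixTriples (by unfold Covered; decide) (l := 24) (by simp only [ZMod.card]; decide)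
  simpa only [ZMod.card] using this

end Even

section Bound

theorem two_mul_ceilDiv (w : ℕ) (hw : 1 ≤ w) :
    (2 * w * ((2 * w - 1) ⌈/⌉ 2)) ⌈/⌉ 3 = (2 * w * w + 2) / 3 := by
  rw [Nat.ceilDiv_eq_add_pred_div, Nat.ceilDiv_eq_add_pred_div,
    show (2 * w - 1 + 2 - 1) / 2 = w by omega]
  rfl

/-- The number of solutions of `3a = 1` in `ZMod w`, and the size of the ceiling. -/
theorem ceil_cases {w : ℕ} [NeZero w] :
    ((thirds (1 : ZMod w)).card = 0 ∧ 3 ∣ w ∧ 2 * w * w ≤ 3 * ((2 * w * w + 2) / 3)) ∨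
    ((thirds (1 : ZMod w)).card = 1 ∧ ¬ 3 ∣ w ∧ 2 * w * w + 1 ≤ 3 * ((2 * w * w + 2) / 3)) := by
  by_cases h : 3 ∣ w
  · exact .inl ⟨card_thirds_one h, h, by omega⟩
  · refine .inr ⟨card_thirds_of_coprime ((Nat.Prime.coprime_iff_not_dvd Nat.prime_three).2 h) 1,
      h, ?_⟩
    have : w * w % 3 = 1 := by
      rcases (by omega : w % 3 = 1 ∨ w % 3 = 2) with h | h <;> simp [Nat.mul_mod, h]
    rw [mul_assoc]
    omega

theorem sum_card_thirds_zmod {w : ℕ} [NeZero w] : ∑ s : ZMod w, (thirds s).card = w := by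
  rw [sum_card_thirds, ZMod.card]

theorem sum_erase_add_const {w : ℕ} [NeZero w] (f : ZMod w → ℕ) {c : ℕ}
    (h : ∀ s, f s ≤ c + 2 * (thirds s).card) :
    ∑ s ∈ univ.erase 1, f s + 2 * (thirds (1 : ZMod w)).card ≤ (w - 1) * c + 2 * w := by
  have h1 := sum_le_sum fun s (_ : s ∈ (univ : Finset (ZMod w)).erase 1) => h s
  have h2 := sum_card_thirds_erase (1 : ZMod w)
  rw [sum_add_distrib, sum_const, card_erase_of_mem (mem_univ _), card_univ, ← mul_sum,
    smul_eq_mul] at h1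
  rw [ZMod.card] at *
  omega

theorem sum_add_const {w : ℕ} [NeZero w] (f : ZMod w → ℕ) {c : ℕ}
    (h : ∀ s, f s ≤ c + 2 * (thirds s).card) : ∑ s, f s ≤ w * c + 2 * w := by
  have h1 := sum_le_sum fun s (_ : s ∈ (univ : Finset (ZMod w))) => h s
  rw [sum_add_distrib, sum_const, card_univ, ← mul_sum, smul_eq_mul, ZMod.card,
    sum_card_thirds_zmod] at h1
  exact h1

theorem coverNumber_le_of_odd {w : ℕ} (hw : Odd w) (h5 : 5 ≤ w) :
    coverNumber (4 * (2 * w)) 5 4 6 ≤ 2 * (coverNumber (2 * w) 5 4 5 + coverNumber (2 * w) 5 4 4) +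
      6 * (w * ((2 * w - 1) * ((2 * w * w + 2) / 3))) := by
  have : NeZero w := ⟨by omega⟩
  obtain ⟨A, B, hA, hB, hA₁, hA₃, hB₁, hB₃, hAc, hBc⟩ := exists_pairCovers_odd hw
  let r := if 3 ∣ w then 3 else 0
  have hE : ∀ s : ZMod w, ∃ E : Finset (Finset (ZMod w)), (∀ t ∈ E, t.card ≤ 3) ∧
      (∀ a, s - a - a ≠ a → Covered E {a, s - a - a}) ∧
      3 * E.card + 2 * (thirds s).card + r ≤ 2 * w := by
    intro s
    by_cases h : 3 ∣ w
    · simpa only [r, if_pos h] using exists_cover_degenerate_of_three_dvd hw h h5 s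
    · obtain ⟨E, h1, h2, h3⟩ := exists_cover_degenerate hw s (Y₀ := ∅) (by simp)
      exact ⟨E, h1, h2, by simp only [r, if_neg h]; omega⟩
  choose E hE₃ hEc hE using hE
  let K : ZMod w → Finset (Finset (ZMod w)) := fun s => sumTriples s ∪ E s
  have hτ : ∀ s : ZMod w, 6 * (sumTriples s).card + 3 * w ≤ w * w + 2 * (thirds s).card := by
    intro s
    simpa only [ZMod.card] using six_mul_card_sumTriples_le s
  have hk : ∀ s, 6 * (K s).card + 2 * (thirds s).card + 2 * r ≤ w * w + w := by
    intro s
    have h1 : (K s).card ≤ _ := card_union_le _ _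
    have h2 := hτ s
    have h3 := hE s
    omega
  have h2 : IsUnit (2 : ZMod w) := by
    have := (ZMod.isUnit_iff_coprime 2 w).2 (Nat.coprime_two_left.2 hw)
    exact_mod_cast this
  obtain ⟨u, hu⟩ := h2.exists_right_inv
  have hmain := coverNumber_le_of_pairCovers (G := ZMod w) (by rw [ZMod.card]; omega) (s₀ := 1)
    (K := K) (Z := ∅) hA (fun s _ => hB s) (fun s => pairCover_sumTriples_union (hE₃ s) (hEc s))
    (fun s => subset_union_left) (by simp)
    (fun y => .inl ⟨u * y, by linear_combination -y * hu⟩) hA₁ hA₃ hB₁ hB₃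
  have hSA := sum_add_const (fun s => 6 * (A s).card) (c := 4 * (w * w)) fun s => by
    have h1 := hAc s
    have h3 := hτ s
    omega
  have hSB := sum_erase_add_const (fun s => 6 * (B s).card) (c := 4 * (w * w)) fun s => by
    have h1 := hBc s
    have h3 := hτ s
    omega
  have hSK : 6 * ∑ s, (K s).card + 2 * w + 2 * r * w ≤ w * (w * w + w) := by
    have h1 := sum_le_sum fun s (_ : s ∈ (univ : Finset (ZMod w))) => hk s
    rw [sum_add_distrib, sum_add_distrib, ← mul_sum, ← mul_sum, sum_card_thirds_zmod, sum_const,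
      sum_const, card_univ, ZMod.card, smul_eq_mul, smul_eq_mul] at h1
    linarith
  have hdiag : ∑ x : ZMod w, (K (x + x)).card = ∑ s, (K s).card := by
    refine Function.Bijective.sum_comp (g := fun s => (K s).card)
      (Finite.injective_iff_bijective.1 fun a b (h : a + a = b + b) => h2.mul_left_cancel ?_)
    linear_combination h
  have hSW := two_mul_sum_card_wedge_le K
  have hoff := sum_offDiag_add_sum_diag fun s => (K s).card
  rw [hdiag] at hoff
  have hk1 := hk 1
  rw [card_empty] at hmain
  simp only [ZMod.card, ← mul_sum] at hmain hSA hSB hSW hoff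
  refine hmain.trans ?_
  generalize ∑ s, (A s).card = a at *
  generalize ∑ s ∈ univ.erase 1, (B s).card = b at *
  generalize ∑ p ∈ univ.offDiag, (wedge K (p.1 + p.2)).card = m at *
  generalize ∑ p ∈ univ.offDiag, (K (p.1 + p.2)).card = q at *
  generalize ∑ s, (K s).card = k at *
  generalize (K 1).card = k₁ at *
  have hnr := ceil_cases (w := w)
  have hr : (r = 3 ∧ (thirds (1 : ZMod w)).card = 0 ∧
      2 * w * w ≤ 3 * ((2 * w * w + 2) / 3)) ∨ (r = 0 ∧ (thirds (1 : ZMod w)).card = 1 ∧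
      2 * w * w + 1 ≤ 3 * ((2 * w * w + 2) / 3)) := by
    rcases hnr with ⟨h1, h, h3⟩ | ⟨h1, h, h3⟩
    · exact .inl ⟨by simp [r, h], h1, h3⟩
    · exact .inr ⟨by simp [r, h], h1, h3⟩
  clear_value r
  clear hnr hmain
  generalize (2 * w * w + 2) / 3 = l at *
  generalize (thirds (1 : ZMod w)).card = n at *
  clear * - hSA hSB hSK hSW hoff hk1 hr h5
  obtain ⟨x, rfl⟩ : ∃ x, w = x + 1 := ⟨w - 1, by omega⟩
  rw [show 2 * (x + 1) - 1 = 2 * x + 1 by omega]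
  rw [Nat.add_sub_cancel] at hSB
  rw [show (x + 1) * (x + 1) - (x + 1) = (x + 1) * x by
    rw [Nat.sub_eq_iff_eq_add (by nlinarith)]; ring] at hSW
  have hq : q = x * k := by linarith
  subst hq
  have p1 := Nat.mul_le_mul_left (x + 1) hSA
  have p2 := Nat.mul_le_mul_left (x + 1) hSB
  have p3 := Nat.mul_le_mul_left x hSK
  have p4 := Nat.mul_le_mul_left (x + 1) hk1
  rcases hr with ⟨rfl, rfl, hl⟩ | ⟨rfl, rfl, hl⟩ <;>
  · have p5 := Nat.mul_le_mul_left ((x + 1) * (2 * x + 1)) hl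
    linarith

theorem coverNumber_le_of_even {w : ℕ} (hw : Even w) (h8 : 8 ≤ w) :
    coverNumber (4 * (2 * w)) 5 4 6 ≤ 2 * (coverNumber (2 * w) 5 4 5 + coverNumber (2 * w) 5 4 4) +
      6 * (w * ((2 * w - 1) * ((2 * w * w + 2) / 3))) := by
  have : NeZero w := ⟨by omega⟩
  choose E hE₃ hEc hE using exists_cover_degenerate_even (w := w) hw
  let K : ZMod w → Finset (Finset (ZMod w)) := fun s => sumTriples s ∪ E s
  have hKp : ∀ s, PairCover (K s) := fun s => pairCover_sumTriples_union (hE₃ s) (hEc s)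
  have hsub : ∀ t : Finset (ZMod w), t.card = 3 → Covered (K (∑ x ∈ t, x)) t := fun t ht =>
    ⟨t, mem_union_left _ (mem_sumTriples.2 ⟨ht, rfl⟩), subset_rfl⟩
  obtain ⟨A, B, hA, hB, hA₁, hB₁, hA₃, hB₃, hAc, hBc⟩ :=
    exists_pairCovers_even (by rwa [ZMod.card]) 1 hKp
  have hτ : ∀ s : ZMod w, 6 * (sumTriples s).card + 3 * w ≤ w * w + 2 * (thirds s).card := by
    intro s
    simpa only [ZMod.card] using six_mul_card_sumTriples_le s
  have hk : ∀ s, 6 * (K s).card ≤ w * w + 2 * (thirds s).card := by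
    intro s
    have h1 : (K s).card ≤ _ := card_union_le _ _
    have h2 := hτ s
    have h3 := hE s
    omega
  let Z : Finset (Finset (ZMod w)) := (range ((w + 3) / 4)).image fun i : ℕ =>
    {((4 * i + 1 : ℕ) : ZMod w), ((4 * i + 3 : ℕ) : ZMod w)}
  have hZc : ∀ y : ZMod w, (∃ x, y = x + x) ∨ ∃ e ∈ Z, y ∈ e := by
    intro y
    have hy : ((y.val : ℕ) : ZMod w) = y := ZMod.natCast_zmod_val y
    have hlt := ZMod.val_lt y
    rw [← hy]
    generalize y.val = j at *
    obtain ⟨i, hi⟩ : ∃ i, j = i + i ∨ j = 4 * i + 1 ∨ j = 4 * i + 3 := by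
      rcases Nat.even_or_odd' j with ⟨k, rfl | rfl⟩
      · exact ⟨k, by omega⟩
      · exact ⟨k / 2, by omega⟩
    rcases hi with rfl | rfl | rfl
    · exact .inl ⟨i, by push_cast; rfl⟩
    · exact .inr ⟨_, mem_image_of_mem _ (mem_range.2 (by omega : i < _)), by simp⟩
    · exact .inr ⟨_, mem_image_of_mem _ (mem_range.2 (by omega : i < _)), by simp⟩
  have hZ : Z.card ≤ (w + 3) / 4 := card_image_le.trans_eq (by simp)
  have hmain := coverNumber_le_of_pairCovers (G := ZMod w) (by rw [ZMod.card]; omega) (s₀ := 1)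
    (K := K) (Z := Z) hA (fun s _ => hB s) hKp (fun s => subset_union_left)
    (fun e he => by obtain ⟨i, -, rfl⟩ := mem_image.1 he; exact card_le_two) hZc hA₁
    (fun t ht => ⟨_, hA₃ _ t (hsub t ht)⟩) (fun x y z h => .inr (hB₁ x y z h))
    (fun t ht hs => ⟨_, hs, hB₃ _ t (hsub t ht)⟩)
  have hSA := sum_add_const (fun s => 6 * (A s).card) (c := 4 * (w * w)) fun s => by
    have h1 := hAc s
    have h3 := hk s
    rw [ZMod.card] at h1
    omega
  have hSB := sum_erase_add_const (fun s => 6 * (B s).card) (c := 4 * (w * w)) fun s => by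
    have h1 := hBc s
    have h3 := hk s
    rw [ZMod.card] at h1
    omega
  have hSW := two_mul_sum_card_wedge_le K
  have hoff := sum_offDiag_add_sum_diag fun s : ZMod w => (thirds s).card
  have hSK : 6 * ∑ p ∈ (univ : Finset (ZMod w)).offDiag, (K (p.1 + p.2)).card ≤
      (w * w - w) * (w * w) + 2 * (w * w) := by
    have h1 := sum_le_sum fun p (_ : p ∈ (univ : Finset (ZMod w)).offDiag) => hk (p.1 + p.2)
    rw [sum_add_distrib, sum_const, ← mul_sum, ← mul_sum, offDiag_card, card_univ, ZMod.card,
      smul_eq_mul] at h1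
    rw [sum_card_thirds_zmod, ZMod.card] at hoff
    omega
  have hk1 := hk 1
  have hτ1 := hτ 1
  simp only [ZMod.card, ← mul_sum] at hmain hSA hSB hSW
  refine hmain.trans ?_
  have hZτ := Nat.mul_le_mul_right (sumTriples (1 : ZMod w)).card hZ
  have hn : ((thirds (1 : ZMod w)).card = 0 ∧ 12 ≤ w ∧ 2 * w * w ≤ 3 * ((2 * w * w + 2) / 3)) ∨
      ((thirds (1 : ZMod w)).card = 1 ∧ 2 * w * w + 1 ≤ 3 * ((2 * w * w + 2) / 3)) := by
    obtain ⟨v, rfl⟩ := hw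
    rcases ceil_cases (w := v + v) with ⟨h1, h, h3⟩ | ⟨h1, h, h3⟩
    · exact .inl ⟨h1, by omega, h3⟩
    · exact .inr ⟨h1, h3⟩
  have hz : 4 * ((w + 3) / 4) ≤ w + 2 := by
    obtain ⟨v, rfl⟩ := hw
    omega
  generalize ∑ s, (A s).card = a at *
  generalize ∑ s ∈ univ.erase 1, (B s).card = b at *
  generalize ∑ p ∈ univ.offDiag, (wedge K (p.1 + p.2)).card = m at *
  generalize ∑ p ∈ univ.offDiag, (K (p.1 + p.2)).card = q at *
  generalize (K 1).card = k₁ at *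
  generalize (2 * w * w + 2) / 3 = l at *
  generalize (thirds (1 : ZMod w)).card = n at *
  generalize (sumTriples (1 : ZMod w)).card = t at *
  generalize Z.card = ζ at *
  generalize (w + 3) / 4 = z at *
  clear * - hSA hSB hSK hSW hk1 hτ1 hn hz hZτ h8
  obtain ⟨x, rfl⟩ : ∃ x, w = x + 1 := ⟨w - 1, by omega⟩
  rw [show 2 * (x + 1) - 1 = 2 * x + 1 by omega]
  rw [Nat.add_sub_cancel] at hSB
  rw [show (x + 1) * (x + 1) - (x + 1) = (x + 1) * x by
    rw [Nat.sub_eq_iff_eq_add (by nlinarith)]; ring] at hSW hSK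
  have p1 := Nat.mul_le_mul_left (x + 1) hSA
  have p2 := Nat.mul_le_mul_left (x + 1) hSB
  have p4 := Nat.mul_le_mul_left (x + 1) hk1
  have p6 := Nat.mul_le_mul_right t hz
  have p7 := Nat.mul_le_mul_left (x + 1 + 2) hτ1
  rcases hn with ⟨rfl, h12, hl⟩ | ⟨rfl, hl⟩
  · have p5 := Nat.mul_le_mul_left ((x + 1) * (2 * x + 1)) hl
    obtain ⟨y, rfl⟩ : ∃ y, x = y + 11 := ⟨x - 11, by omega⟩
    ring_nf at *
    nlinarith only [p1, p2, p4, p5, p6, p7, hSW, hSK, hZτ, Nat.zero_le (y ^ 2), Nat.zero_le (y ^ 3)]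
  · have p5 := Nat.mul_le_mul_left ((x + 1) * (2 * x + 1)) hl
    obtain ⟨y, rfl⟩ : ∃ y, x = y + 7 := ⟨x - 7, by omega⟩
    ring_nf at *
    nlinarith only [p1, p2, p4, p5, p6, p7, hSW, hSK, hZτ, Nat.zero_le (y ^ 2), Nat.zero_le (y ^ 3)]

end Bound

/-- For every even integer `v ≥ 8`,
`C(4v,5,4,6) ≤ 2(C(v,5,4,5) + C(v,5,4)) + 3v(v-1)⌈(v/3)⌈(v-1)/2⌉⌉`,
where `⌈/⌉` denotes ceiling division on ℕ. -/
theorem bound_4v_546 (v : ℕ) (hv : Even v) (hv8 : 8 ≤ v) :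
    coverNumber (4 * v) 5 4 6 ≤
      2 * (coverNumber v 5 4 5 + coverNumber v 5 4 4) +
        3 * v * (v - 1) * ((v * ((v - 1) ⌈/⌉ 2)) ⌈/⌉ 3) := by
  obtain ⟨w, rfl⟩ := hv
  rw [← two_mul] at *
  rw [two_mul_ceilDiv w (by omega), show 3 * (2 * w) * (2 * w - 1) * ((2 * w * w + 2) / 3) =
    6 * (w * ((2 * w - 1) * ((2 * w * w + 2) / 3))) by ring]
  rcases Nat.even_or_odd w with hw | hw
  · rcases (by obtain ⟨k, rfl⟩ := hw; omega : w = 4 ∨ w = 6 ∨ 8 ≤ w) with rfl | rfl | h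
    · exact coverNumber_sixteen_le
    · exact coverNumber_twentyfour_le
    · exact coverNumber_le_of_even hw h
  · exact coverNumber_le_of_odd hw (by obtain ⟨k, rfl⟩ := hw; omega)
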